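/- arXiv:1602.09092 — 8 statements merged into one kernel-verified Lean document; each statement's English description precedes it below -/
import Mathlib

section
/- There exists a constant C > 0 such that for every complex-valued function u ∈ C²([0,1]) with u(0) = u'(0) = 0 and every parameter λ > 1, the Carleman estimate ∫₀¹ |u''(x)|² e^{−2λx} dx ≥ C ( λ ∫₀¹ |u'(x)|² e^{−2λx} dx + λ³ ∫₀¹ |u(x)|² e^{−2λx} dx ) holds, where the constant C is independent of u and λ. -/
open MeasureTheory

/-- Weighted Hardy-type inequality for a `C¹` function vanishing at the left endpoint. -/
theorem sq_mul_integral_norm_sq_mul_exp_le {E : Type*} [NormedAddCommGroup E]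
    [InnerProductSpace ℝ E] {v : ℝ → E} (hv : ContDiff ℝ 1 v) (h0 : v 0 = 0) {l : ℝ}
    (hl : 0 < l) :
    l ^ 2 * (∫ x in (0:ℝ)..1, ‖v x‖ ^ 2 * Real.exp (-2 * l * x)) ≤
      ∫ x in (0:ℝ)..1, ‖deriv v x‖ ^ 2 * Real.exp (-2 * l * x) := by
  have hc : Continuous v := hv.continuous
  have hc' : Continuous (deriv v) := hv.continuous_deriv le_rfl
  have hd (x : ℝ) : HasDerivAt (fun x ↦ ‖v x‖ ^ 2 * Real.exp (-2 * l * x))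
      (2 * inner ℝ (v x) (deriv v x) * Real.exp (-2 * l * x)
        + ‖v x‖ ^ 2 * (Real.exp (-2 * l * x) * (-2 * l))) x := by
    have hexp : HasDerivAt (fun x : ℝ ↦ Real.exp (-2 * l * x))
        (Real.exp (-2 * l * x) * (-2 * l)) x := by
      simpa using ((hasDerivAt_id x).const_mul (-2 * l)).exp
    exact ((hv.differentiable one_ne_zero x).hasDerivAt.norm_sq).mul hexp
  have hftc := intervalIntegral.integral_eq_sub_of_hasDerivAt (a := 0) (b := 1)
    (fun x _ ↦ hd x) (Continuous.intervalIntegrable (by fun_prop) _ _)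
  have hmono := intervalIntegral.integral_mono_on (μ := volume) (a := 0) (b := 1) zero_le_one
    (f := fun x ↦ l * (2 * inner ℝ (v x) (deriv v x) * Real.exp (-2 * l * x)
        + ‖v x‖ ^ 2 * (Real.exp (-2 * l * x) * (-2 * l))))
    (g := fun x ↦ ‖deriv v x‖ ^ 2 * Real.exp (-2 * l * x)
        - l ^ 2 * (‖v x‖ ^ 2 * Real.exp (-2 * l * x)))
    (Continuous.intervalIntegrable (by fun_prop) _ _)
    (Continuous.intervalIntegrable (by fun_prop) _ _) (fun x _ ↦ by
      have hi := real_inner_le_norm (v x) (deriv v x)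
      have hq : 2 * l * inner ℝ (v x) (deriv v x) ≤ ‖deriv v x‖ ^ 2 + l ^ 2 * ‖v x‖ ^ 2 := by
        nlinarith [sq_nonneg (‖deriv v x‖ - l * ‖v x‖), mul_le_mul_of_nonneg_left hi hl.le]
      linarith [mul_le_mul_of_nonneg_right hq (Real.exp_pos (-2 * l * x)).le])
  rw [intervalIntegral.integral_const_mul, hftc, intervalIntegral.integral_sub
    (Continuous.intervalIntegrable (by fun_prop) _ _)
    (Continuous.intervalIntegrable (by fun_prop) _ _), intervalIntegral.integral_const_mul, h0]
    at hmono
  have hpos : 0 ≤ l * (‖v 1‖ ^ 2 * Real.exp (-2 * l * 1)) := by positivity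
  simp only [norm_zero] at hmono
  linarith

/-- Carleman estimate for the operator d²/dx² on (0,1). -/
theorem carleman_estimate_second_derivative :
    ∃ C : ℝ, 0 < C ∧
      ∀ u : ℝ → ℂ, ContDiff ℝ 2 u → u 0 = 0 → deriv u 0 = 0 →
        ∀ l : ℝ, 1 < l →
          (∫ x in (0:ℝ)..1, ‖deriv (deriv u) x‖ ^ 2 * Real.exp (-2 * l * x)) ≥
            C * (l * (∫ x in (0:ℝ)..1, ‖deriv u x‖ ^ 2 * Real.exp (-2 * l * x))
              + l ^ 3 * (∫ x in (0:ℝ)..1, ‖u x‖ ^ 2 * Real.exp (-2 * l * x))) := by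
  refine ⟨1 / 2, by norm_num, fun u hu h0 h1 l hl ↦ ?_⟩
  have hl0 : 0 < l := by linarith
  have hu' : ContDiff ℝ 1 (deriv u) := ContDiff.deriv' (by simpa [one_add_one_eq_two] using hu)
  have e0 := sq_mul_integral_norm_sq_mul_exp_le (hu.of_le one_le_two) h0 hl0
  have e1 := sq_mul_integral_norm_sq_mul_exp_le hu' h1 hl0
  have hn : 0 ≤ ∫ x in (0:ℝ)..1, ‖deriv u x‖ ^ 2 * Real.exp (-2 * l * x) :=
    intervalIntegral.integral_nonneg zero_le_one fun x _ ↦ by positivity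
  have e2 := mul_le_mul_of_nonneg_left e0 hl0.le
  have e3 := mul_le_mul_of_nonneg_right (show l ≤ l ^ 2 by nlinarith) hn
  linarith
end

section
/- Let u ∈ C²([0,1]) be real-valued and λ > 1, and set v(x) = u(x) e^{−λx}. Then for every x ∈ [0,1] one has the pointwise inequality (u''(x))² e^{−2λx}/(x+1) ≥ d/dx [ (2λ (v'(x))² + 2λ³ (v(x))²)/(x+1) ] + (2λ/(x+1)²) ( (v'(x))² + λ² (v(x))² ). -/
open MeasureTheory

/-- The derivative of a function weighted by `exp (-l * x)`. -/
lemma HasDerivAt.mul_exp_neg_mul {f : ℝ → ℝ} {f' x : ℝ} (hf : HasDerivAt f f' x) (l : ℝ) :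
    HasDerivAt (fun y => f y * Real.exp (-l * y)) ((f' - l * f x) * Real.exp (-l * x)) x := by
  have he : HasDerivAt (fun y => Real.exp (-l * y)) (Real.exp (-l * x) * (-l * 1)) x :=
    ((hasDerivAt_id x).const_mul (-l)).exp
  exact (hf.mul he).congr_deriv (by ring)

/-- Pointwise differential inequality used in the proof of the Carleman estimate. -/
theorem pointwise_carleman_inequality
    (u : ℝ → ℝ) (hu : ContDiff ℝ 2 u) (l : ℝ) (hl : 1 < l)
    (v : ℝ → ℝ) (hv : v = fun x => u x * Real.exp (-l * x)) :
    ∀ x ∈ Set.Icc (0:ℝ) 1,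
      (deriv (deriv u) x) ^ 2 * Real.exp (-2 * l * x) / (x + 1) ≥
        deriv (fun y => (2 * l * (deriv v y) ^ 2 + 2 * l ^ 3 * (v y) ^ 2) / (y + 1)) x
          + (2 * l / (x + 1) ^ 2) * ((deriv v x) ^ 2 + l ^ 2 * (v x) ^ 2) := by
  intro x hx
  have hx1 : 0 < x + 1 := by linarith [hx.1]
  have hu1 (y : ℝ) : HasDerivAt u (deriv u y) y :=
    (hu.differentiable (by norm_num) y).hasDerivAt
  have hu2 : HasDerivAt (deriv u) (deriv (deriv u) x) x :=
    (hu.differentiable_deriv_two x).hasDerivAt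
  have hv1 (y : ℝ) : HasDerivAt v ((deriv u y - l * u y) * Real.exp (-l * y)) y :=
    hv ▸ (hu1 y).mul_exp_neg_mul l
  have hdv : deriv v = fun y => (deriv u y - l * u y) * Real.exp (-l * y) :=
    funext fun y => (hv1 y).deriv
  obtain ⟨w, hw⟩ : ∃ w, w = (deriv (deriv u) x - l * deriv u x
      - l * (deriv u x - l * u x)) * Real.exp (-l * x) := ⟨_, rfl⟩
  have hv2 : HasDerivAt (deriv v) w x := by
    rw [hdv, hw]
    exact (hu2.sub ((hu1 x).const_mul l)).mul_exp_neg_mul l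
  have hvx : HasDerivAt v (deriv v x) x := (hv1 x).differentiableAt.hasDerivAt
  have hquot := ((((hv2.pow 2).const_mul (2 * l)).add
    ((hvx.pow 2).const_mul (2 * l ^ 3))).div ((hasDerivAt_id x).add_const 1) hx1.ne').deriv
  have hsq : (deriv (deriv u) x) ^ 2 * Real.exp (-2 * l * x)
      = (w + 2 * l * deriv v x + l ^ 2 * v x) ^ 2 := by
    have he : Real.exp (-2 * l * x) = Real.exp (-l * x) ^ 2 := by
      rw [← Real.exp_nat_mul]
      congr 1
      push_cast
      ring
    rw [he, hw, hdv, hv]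
    ring
  have hrhs : deriv (fun y => (2 * l * (deriv v y) ^ 2 + 2 * l ^ 3 * (v y) ^ 2) / (y + 1)) x
      + (2 * l / (x + 1) ^ 2) * ((deriv v x) ^ 2 + l ^ 2 * (v x) ^ 2)
      = 4 * l * deriv v x * (w + l ^ 2 * v x) / (x + 1) := by
    refine (congrArg (· + _) hquot).trans ?_
    simp only [Pi.add_apply, Pi.pow_apply, id]
    field_simp
    push_cast
    ring
  rw [ge_iff_le, hrhs, hsq]
  gcongr
  nlinarith [sq_nonneg (w + l ^ 2 * v x), sq_nonneg (2 * l * deriv v x)]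
end

section
/- Let a, b ∈ C([0,1], ℂ) and define the operator L w = w'' + a(x) w' + b(x) w. Then there exist constants C > 0 and λ > 1, depending only on the sup-norms ‖a‖_{C[0,1]} and ‖b‖_{C[0,1]}, such that for every v ∈ C²([0,1], ℂ) with v(0) = v'(0) = 0, ∫₀¹ |L v(x)|² dx ≥ C e^{−2λ} ∫₀¹ ( |v''(x)|² + |v'(x)|² + |v(x)|² ) dx. -/
open MeasureTheory

/-- Pointwise bound on the leading term of a second order operator by the value of the operator
and the lower order terms. -/
theorem norm_sq_leading_le {A B : ℝ} {a b p q r : ℂ} (ha : ‖a‖ ≤ A) (hb : ‖b‖ ≤ B) :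
    ‖r‖ ^ 2 ≤ 3 * ‖r + a * q + b * p‖ ^ 2 + (3 * A ^ 2 + 3 * B ^ 2) * (‖p‖ ^ 2 + ‖q‖ ^ 2) := by
  have h : ‖r‖ ≤ ‖r + a * q + b * p‖ + A * ‖q‖ + B * ‖p‖ := by
    calc ‖r‖ = ‖(r + a * q + b * p) - a * q - b * p‖ := by ring_nf
      _ ≤ ‖(r + a * q + b * p) - a * q‖ + ‖b * p‖ := norm_sub_le _ _
      _ ≤ ‖r + a * q + b * p‖ + ‖a * q‖ + ‖b * p‖ := by gcongr; exact norm_sub_le _ _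
      _ ≤ _ := by rw [norm_mul, norm_mul]; gcongr
  have h2 := pow_le_pow_left₀ (norm_nonneg r) h 2
  nlinarith [sq_nonneg (‖r + a * q + b * p‖ - A * ‖q‖), sq_nonneg (‖r + a * q + b * p‖ - B * ‖p‖),
    sq_nonneg (A * ‖q‖ - B * ‖p‖), mul_nonneg (sq_nonneg A) (sq_nonneg ‖p‖),
    mul_nonneg (sq_nonneg B) (sq_nonneg ‖q‖)]

/-- Integral form of Grönwall's inequality for a differential inequality `N' ≤ K N + g`
with zero initial value. -/
theorem le_exp_mul_integral_of_deriv_le {K : ℝ} (hK : 0 ≤ K) {N N' g : ℝ → ℝ}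
    (hN : ∀ x, HasDerivAt N (N' x) x) (hN' : Continuous N') (hN0 : N 0 = 0)
    (hg : ContinuousOn g (Set.Icc 0 1)) (hg0 : ∀ x ∈ Set.Icc (0 : ℝ) 1, 0 ≤ g x)
    (h : ∀ x ∈ Set.Icc (0 : ℝ) 1, N' x ≤ K * N x + g x) {x : ℝ} (hx : x ∈ Set.Icc (0 : ℝ) 1) :
    N x ≤ Real.exp K * ∫ t in (0 : ℝ)..1, g t := by
  have hNc : Continuous N := continuous_iff_continuousAt.2 fun t => (hN t).continuousAt
  have hd : ∀ t, HasDerivAt (fun t => Real.exp (-K * t) * N t)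
      (Real.exp (-K * t) * (N' t - K * N t)) t := by
    intro t
    have he : HasDerivAt (fun t : ℝ => Real.exp (-K * t)) (Real.exp (-K * t) * (-K)) t := by
      simpa using ((hasDerivAt_id t).const_mul (-K)).exp
    exact (he.mul (hN t)).congr_deriv (by ring)
  have hdc : Continuous fun t => Real.exp (-K * t) * (N' t - K * N t) := by fun_prop
  have hi := intervalIntegral.integral_eq_sub_of_hasDerivAt (fun t _ => hd t)
    (hdc.intervalIntegrable 0 x)
  simp only [hN0, mul_zero, sub_zero] at hi
  have hg1 : IntervalIntegrable g volume 0 1 :=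
    ContinuousOn.intervalIntegrable (by rwa [Set.uIcc_of_le zero_le_one])
  have hgx : IntervalIntegrable g volume 0 x :=
    ContinuousOn.intervalIntegrable (by
      rw [Set.uIcc_of_le hx.1]; exact hg.mono (Set.Icc_subset_Icc_right hx.2))
  have h1 : Real.exp (-K * x) * N x ≤ ∫ t in (0 : ℝ)..x, g t := by
    rw [← hi]
    refine intervalIntegral.integral_mono_on hx.1 (hdc.intervalIntegrable 0 x) hgx fun t ht => ?_
    have ht' : t ∈ Set.Icc (0 : ℝ) 1 := ⟨ht.1, ht.2.trans hx.2⟩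
    have he : Real.exp (-K * t) ≤ 1 := Real.exp_le_one_iff.2 (by nlinarith [ht.1])
    calc Real.exp (-K * t) * (N' t - K * N t) ≤ Real.exp (-K * t) * g t := by
          gcongr; linarith [h t ht']
      _ ≤ g t := mul_le_of_le_one_left (hg0 t ht') he
  have h2 : ∫ t in (0 : ℝ)..x, g t ≤ ∫ t in (0 : ℝ)..1, g t := by
    refine intervalIntegral.integral_mono_interval le_rfl hx.1 hx.2 ?_ hg1
    filter_upwards [ae_restrict_mem measurableSet_Ioc] with t ht
    exact hg0 t (Set.Ioc_subset_Icc_self ht)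
  have h0 : 0 ≤ ∫ t in (0 : ℝ)..1, g t :=
    intervalIntegral.integral_nonneg zero_le_one hg0
  calc N x = Real.exp (K * x) * (Real.exp (-K * x) * N x) := by
        rw [← mul_assoc, ← Real.exp_add]; simp
    _ ≤ Real.exp (K * x) * ∫ t in (0 : ℝ)..1, g t := by gcongr; exact h1.trans h2
    _ ≤ Real.exp K * ∫ t in (0 : ℝ)..1, g t := by
        gcongr; exact mul_le_of_le_one_right hK hx.2

/-- Carleman-type lower bound for a general second order operator L w = w'' + a w' + b w,
with constants depending only on the sup-norms of the coefficients. -/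
theorem operator_carleman_lower_bound (A B : ℝ) :
    ∃ C : ℝ, 0 < C ∧ ∃ l : ℝ, 1 < l ∧
      ∀ a b : ℝ → ℂ, ContinuousOn a (Set.Icc 0 1) → ContinuousOn b (Set.Icc 0 1) →
        (∀ x ∈ Set.Icc (0:ℝ) 1, ‖a x‖ ≤ A) → (∀ x ∈ Set.Icc (0:ℝ) 1, ‖b x‖ ≤ B) →
        ∀ v : ℝ → ℂ, ContDiff ℝ 2 v → v 0 = 0 → deriv v 0 = 0 →
          (∫ x in (0:ℝ)..1, ‖deriv (deriv v) x + a x * deriv v x + b x * v x‖ ^ 2) ≥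
            C * Real.exp (-2 * l) *
              ∫ x in (0:ℝ)..1, (‖deriv (deriv v) x‖ ^ 2 + ‖deriv v x‖ ^ 2 + ‖v x‖ ^ 2) := by
  set K : ℝ := 2 + (3 * A ^ 2 + 3 * B ^ 2) with hKdef
  have hK : 0 < K := by positivity
  set M : ℝ := 3 + K * (Real.exp K * 3) with hMdef
  have hM : 0 < M := by positivity
  refine ⟨Real.exp 4 / M, by positivity, 2, by norm_num, ?_⟩
  intro a b ha hb hA hB v hv hv0 hv0'
  have hv1 : ContDiff ℝ 1 (deriv v) := ((contDiff_succ_iff_deriv (n := 1)).1 hv).2.2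
  have hd0 : ∀ x, HasDerivAt v (deriv v x) x := fun x =>
    (hv.differentiable (by norm_num) x).hasDerivAt
  have hd1 : ∀ x, HasDerivAt (deriv v) (deriv (deriv v) x) x := fun x =>
    (hv1.differentiable (by norm_num) x).hasDerivAt
  have hc0 : Continuous v := hv.continuous
  have hc1 : Continuous (deriv v) := hv1.continuous
  have hc2 : Continuous (deriv (deriv v)) := hv1.continuous_deriv le_rfl
  set f : ℝ → ℝ := fun x => ‖deriv (deriv v) x + a x * deriv v x + b x * v x‖ ^ 2 with hf
  have hfc : ContinuousOn f (Set.Icc 0 1) :=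
    (((hc2.continuousOn.add (ha.mul hc1.continuousOn)).add (hb.mul hc0.continuousOn)).norm).pow 2
  have hfi : IntervalIntegrable f volume 0 1 :=
    ContinuousOn.intervalIntegrable (by rwa [Set.uIcc_of_le zero_le_one])
  have hlead : ∀ x ∈ Set.Icc (0 : ℝ) 1, ‖deriv (deriv v) x‖ ^ 2 ≤
      3 * f x + (3 * A ^ 2 + 3 * B ^ 2) * (‖v x‖ ^ 2 + ‖deriv v x‖ ^ 2) := fun x hx =>
    norm_sq_leading_le (hA x hx) (hB x hx)
  have hlow : ∀ x ∈ Set.Icc (0 : ℝ) 1, ‖v x‖ ^ 2 + ‖deriv v x‖ ^ 2 ≤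
      Real.exp K * ∫ t in (0 : ℝ)..1, 3 * f t := by
    intro x hx
    refine le_exp_mul_integral_of_deriv_le hK.le (g := fun t => 3 * f t)
      (N := fun t => ‖v t‖ ^ 2 + ‖deriv v t‖ ^ 2)
      (fun t => (hd0 t).norm_sq.add (hd1 t).norm_sq) (by fun_prop) (by simp [hv0, hv0'])
      (continuousOn_const.mul hfc) (fun t _ => by positivity) (fun t ht => ?_) hx
    have h1 := real_inner_le_norm (v t) (deriv v t)
    have h2 := real_inner_le_norm (deriv v t) (deriv (deriv v) t)
    simp only [hKdef]
    nlinarith [hlead t ht, sq_nonneg (‖v t‖ - ‖deriv v t‖), sq_nonneg ‖v t‖,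
      sq_nonneg (‖deriv v t‖ - ‖deriv (deriv v) t‖)]
  rw [intervalIntegral.integral_const_mul] at hlow
  set F : ℝ := ∫ t in (0 : ℝ)..1, f t with hF
  have hmain : ∫ x in (0 : ℝ)..1,
      (‖deriv (deriv v) x‖ ^ 2 + ‖deriv v x‖ ^ 2 + ‖v x‖ ^ 2) ≤ M * F := by
    calc _ ≤ ∫ x in (0 : ℝ)..1, (3 * f x + K * (Real.exp K * (3 * F))) := by
          refine intervalIntegral.integral_mono_on zero_le_one
            (Continuous.intervalIntegrable (by fun_prop) _ _)
            ((hfi.const_mul 3).add intervalIntegrable_const) fun x hx => ?_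
          have h1 := mul_le_mul_of_nonneg_left (hlow x hx) hK.le
          rw [hKdef] at h1 ⊢
          nlinarith [hlead x hx, sq_nonneg ‖v x‖, sq_nonneg ‖deriv v x‖]
      _ = M * F := by
          rw [intervalIntegral.integral_add (hfi.const_mul 3) intervalIntegrable_const,
            intervalIntegral.integral_const_mul, intervalIntegral.integral_const]
          simp only [hMdef, smul_eq_mul]
          ring
  have hexp : Real.exp 4 / M * Real.exp (-2 * 2) = M⁻¹ := by
    rw [div_mul_eq_mul_div, ← Real.exp_add]; norm_num
  rw [ge_iff_le, hexp, inv_mul_le_iff₀ hM]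
  exact hmain
end

section
/- Let k > 0 and let β : ℝ → ℝ be continuous with β(x) = 0 for all x ∉ (0,1) and 1 + β(x) > 0 for all x. Suppose U ∈ C²(ℝ, ℂ) satisfies U''(x) + k²(1 + β(x)) U(x) = 0 on ℝ, and suppose there exist B₁, B₂ ∈ ℂ such that U(x) = B₁ e^{−i k x} for all x ≥ 1 and U(x) = B₂ e^{i k x} for all x ≤ 0. Then B₁ = B₂ = 0 and U(x) = 0 for all x ∈ ℝ. (Uniqueness for the 1-d Helmholtz scattering problem.) -/
open MeasureTheory

/-- A solution of a linear second order equation `U'' = q U` with bounded real coefficient `q`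
vanishes identically once its Cauchy data vanish at one point. -/
theorem eq_zero_of_cauchy_data_eq_zero {q : ℝ → ℝ} {M : ℝ} (hM : ∀ x, |q x| ≤ M)
    {U V : ℝ → ℂ} (hU : ∀ x, HasDerivAt U (V x) x) (hV : ∀ x, HasDerivAt V (q x * U x) x)
    {x₀ : ℝ} (hU₀ : U x₀ = 0) (hV₀ : V x₀ = 0) (x : ℝ) : U x = 0 := by
  have hM0 : 0 ≤ M := (abs_nonneg _).trans (hM 0)
  let v : ℝ → ℂ × ℂ → ℂ × ℂ := fun t p => (p.2, q t * p.1)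
  have hv : ∀ t, LipschitzOnWith (Real.toNNReal (1 + M)) (v t) Set.univ := by
    intro t
    refine LipschitzOnWith.of_dist_le_mul fun p _ r _ => ?_
    rw [Real.coe_toNNReal _ (by positivity), dist_eq_norm, dist_eq_norm, Prod.norm_def]
    have h1 := norm_fst_le (p - r)
    have h2 := norm_snd_le (p - r)
    have h3 := norm_nonneg (p - r)
    refine max_le ?_ ?_
    · change ‖(p - r).2‖ ≤ _
      nlinarith
    · change ‖(q t : ℂ) * p.1 - q t * r.1‖ ≤ _
      rw [← mul_sub, norm_mul, Complex.norm_real, Real.norm_eq_abs]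
      calc |q t| * ‖p.1 - r.1‖ ≤ M * ‖p - r‖ := mul_le_mul (hM t) h1 (norm_nonneg _) hM0
        _ ≤ (1 + M) * ‖p - r‖ := by nlinarith
  have key := ODE_solution_unique_univ (t₀ := x₀) (v := v) (s := fun _ => Set.univ)
    (f := fun t => (U t, V t)) (g := fun _ => 0) hv
    (fun t => ⟨(hU t).prodMk (hV t), trivial⟩)
    (fun t => ⟨by simpa [v, Prod.mk_zero_zero] using hasDerivAt_const t (0 : ℂ × ℂ), trivial⟩)
    (by simp [hU₀, hV₀])
  exact congrArg Prod.fst (congrFun key x)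

/-- The flux `U * conj U' - conj U * U'` of a solution of `U'' = q U`, with `q` real, is constant. -/
theorem flux_eq {q : ℝ → ℝ} {U V : ℝ → ℂ} (hU : ∀ x, HasDerivAt U (V x) x)
    (hV : ∀ x, HasDerivAt V (q x * U x) x) (a b : ℝ) :
    U a * star (V a) - star (U a) * V a = U b * star (V b) - star (U b) * V b := by
  have h : ∀ x, HasDerivAt (fun x => U x * star (V x) - star (U x) * V x) 0 x := by
    intro x
    refine (((hU x).mul (hV x).star).sub ((hU x).star.mul (hV x))).congr_deriv ?_
    simp
    ring
  exact is_const_of_deriv_eq_zero (fun x => (h x).differentiableAt) (fun x => (h x).deriv) a b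

/-- Uniqueness for the 1-d Helmholtz scattering problem: an outgoing solution of
U'' + k²(1+β)U = 0 on ℝ vanishes identically. -/
theorem helmholtz_scattering_uniqueness
    (k : ℝ) (hk : 0 < k) (β : ℝ → ℝ) (hβc : Continuous β)
    (hβ0 : ∀ x : ℝ, x ∉ Set.Ioo (0:ℝ) 1 → β x = 0)
    (hβpos : ∀ x : ℝ, 0 < 1 + β x)
    (U : ℝ → ℂ) (hU : ContDiff ℝ 2 U)
    (heq : ∀ x : ℝ, deriv (deriv U) x + (k : ℂ) ^ 2 * (1 + (β x : ℂ)) * U x = 0)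
    (B₁ B₂ : ℂ)
    (h1 : ∀ x : ℝ, 1 ≤ x → U x = B₁ * Complex.exp (-(Complex.I * k * x)))
    (h2 : ∀ x : ℝ, x ≤ 0 → U x = B₂ * Complex.exp (Complex.I * k * x)) :
    B₁ = 0 ∧ B₂ = 0 ∧ ∀ x : ℝ, U x = 0 := by
  have hU' : ∀ x, HasDerivAt U (deriv U x) x := fun x =>
    (hU.differentiable (by norm_num) x).hasDerivAt
  have hdU : ContDiff ℝ 1 (deriv U) := ((contDiff_succ_iff_deriv (n := 1)).1 hU).2.2
  have hV : ∀ x, HasDerivAt (deriv U) ((-(k ^ 2 * (1 + β x)) : ℝ) * U x) x := fun x => by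
    refine (hdU.differentiable (by norm_num) x).hasDerivAt.congr_deriv ?_
    push_cast
    linear_combination heq x
  have hexp : ∀ (c : ℂ) (x : ℝ),
      HasDerivAt (fun x : ℝ => Complex.exp (c * x)) (c * Complex.exp (c * x)) x := fun c x => by
    simpa [mul_comm] using ((hasDerivAt_id x).ofReal_comp.const_mul c).cexp
  have hright : deriv U 2 = -(Complex.I * k) * U 2 := by
    have h := (hexp (-(Complex.I * k)) 2).const_mul B₁
    have he : U =ᶠ[nhds 2] fun x : ℝ => B₁ * Complex.exp (-(Complex.I * k) * x) := by
      filter_upwards [Ioi_mem_nhds (show (1 : ℝ) < 2 by norm_num)] with x hx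
      rw [h1 x (le_of_lt hx), neg_mul]
    rw [he.deriv_eq, h.deriv, he.eq_of_nhds]
    ring
  have hleft : deriv U (-1) = Complex.I * k * U (-1) := by
    have h := (hexp (Complex.I * k) (-1)).const_mul B₂
    have he : U =ᶠ[nhds (-1)] fun x : ℝ => B₂ * Complex.exp (Complex.I * k * x) := by
      filter_upwards [Iio_mem_nhds (show (-1 : ℝ) < 0 by norm_num)] with x hx
      exact h2 x (le_of_lt hx)
    rw [he.deriv_eq, h.deriv, he.eq_of_nhds]
    ring
  have hsum : Complex.normSq (U 2) + Complex.normSq (U (-1)) = 0 := by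
    have hf := flux_eq hU' hV 2 (-1)
    rw [hright, hleft] at hf
    simp only [star_mul', star_neg, Complex.star_def, Complex.conj_I, Complex.conj_ofReal] at hf
    have hz : 2 * Complex.I * k *
        ((Complex.normSq (U 2) + Complex.normSq (U (-1)) : ℝ) : ℂ) = 0 := by
      rw [Complex.ofReal_add, ← Complex.mul_conj, ← Complex.mul_conj]
      linear_combination hf
    have hk' : (k : ℂ) ≠ 0 := by exact_mod_cast hk.ne'
    simpa only [mul_eq_zero, Complex.I_ne_zero, hk', two_ne_zero, false_or,
      Complex.ofReal_eq_zero] using hz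
  have hnn₁ := Complex.normSq_nonneg (U 2)
  have hnn₂ := Complex.normSq_nonneg (U (-1))
  have hU₂ : U 2 = 0 := Complex.normSq_eq_zero.1 (by linarith)
  have hU₁ : U (-1) = 0 := Complex.normSq_eq_zero.1 (by linarith)
  refine ⟨?_, ?_, ?_⟩
  · simpa [Complex.exp_ne_zero] using (h1 2 (by norm_num)).symm.trans hU₂
  · simpa [Complex.exp_ne_zero] using (h2 (-1) (by norm_num)).symm.trans hU₁
  · obtain ⟨C, hC⟩ := hβc.bounded_above_of_compact_support
      (HasCompactSupport.intro (isCompact_Icc (a := (0 : ℝ)) (b := 1))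
        fun x hx => hβ0 x fun h => hx (Set.Ioo_subset_Icc_self h))
    refine eq_zero_of_cauchy_data_eq_zero (M := k ^ 2 * (1 + C)) (fun x => ?_) hU' hV hU₂
      (by rw [hright, hU₂, mul_zero])
    rw [abs_neg, abs_of_pos (mul_pos (by positivity) (hβpos x))]
    gcongr
    exact (le_abs_self _).trans (hC x)
end

section
/- Let k > 0, let c : ℝ → ℝ be continuous with c(x) > 0 for all x and c(x) = 1 for all x ≥ 1, and let x₁ ∈ ℝ. Suppose U ∈ C²([x₁, ∞), ℂ) satisfies U''(x) + k² c(x) U(x) = 0 on (x₁, ∞), U(x₁) = 0, and the radiation condition lim_{x→∞} ( U'(x) + i k U(x) ) = 0. Then U(x) = 0 for all x ≥ x₁. (Consequently, a solution of the scattering problem which is outgoing at +∞ and not identically zero never vanishes.) -/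
open MeasureTheory

lemma eq_of_hasDerivAt_zero_on_Ioi {f : ℝ → ℝ} {s : ℝ} (hf : Continuous f)
    (h : ∀ x ∈ Set.Ioi s, HasDerivAt f 0 x) {x : ℝ} (hx : s ≤ x) : f x = f s := by
  rcases hx.eq_or_lt with rfl | hlt
  · rfl
  obtain ⟨y, -, hy⟩ := exists_hasDerivAt_eq_slope f (fun _ => 0) hlt hf.continuousOn
    fun y hy => h y hy.1
  have hne : x - s ≠ 0 := sub_ne_zero.2 hlt.ne'
  rw [eq_comm, div_eq_zero_iff, or_iff_left hne] at hy
  linarith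

/-- Backward Grönwall uniqueness for a nonnegative function. -/
lemma eq_zero_of_neg_mul_le_deriv {f f' : ℝ → ℝ} {s t K : ℝ} (hf : Continuous f)
    (hf0 : ∀ x, 0 ≤ f x) (h : ∀ x ∈ Set.Ioo s t, HasDerivAt f (f' x) x)
    (hK : ∀ x ∈ Set.Ioo s t, -K * f x ≤ f' x) (ht : f t = 0) :
    ∀ x ∈ Set.Icc s t, f x = 0 := by
  have hd : ∀ x ∈ Set.Ioo s t, HasDerivAt (fun x => f x * Real.exp (K * x))
      (f' x * Real.exp (K * x) + f x * (Real.exp (K * x) * (K * 1))) x := fun x hx =>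
    (h x hx).mul ((hasDerivAt_id' x).const_mul K).exp
  have hmono : MonotoneOn (fun x => f x * Real.exp (K * x)) (Set.Icc s t) := by
    refine monotoneOn_of_deriv_nonneg (convex_Icc s t) (by fun_prop) ?_ ?_
    · rw [interior_Icc]
      exact fun x hx => (hd x hx).differentiableAt.differentiableWithinAt
    · rw [interior_Icc]
      intro x hx
      rw [(hd x hx).deriv]
      nlinarith [mul_nonneg (sub_nonneg.2 (hK x hx)) (Real.exp_pos (K * x)).le]
  intro x hx
  have hle := hmono hx (Set.right_mem_Icc.2 (hx.1.trans hx.2)) hx.2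
  simp only [ht, zero_mul] at hle
  exact le_antisymm (nonpos_of_mul_nonpos_left hle (Real.exp_pos _)) (hf0 x)

/-- An outgoing solution of U'' + k²c U = 0 on (x₁, ∞) (with c = 1 near +∞) which
vanishes at x₁ vanishes identically on [x₁, ∞). -/
theorem outgoing_solution_vanishing_implies_zero
    (k : ℝ) (hk : 0 < k) (c : ℝ → ℝ) (hc : Continuous c) (hcpos : ∀ x : ℝ, 0 < c x)
    (hc1 : ∀ x : ℝ, 1 ≤ x → c x = 1) (x₁ : ℝ)
    (U : ℝ → ℂ) (hU : ContDiff ℝ 2 U)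
    (heq : ∀ x ∈ Set.Ioi x₁, deriv (deriv U) x + (k : ℂ) ^ 2 * (c x : ℂ) * U x = 0)
    (hU0 : U x₁ = 0)
    (hrad : Filter.Tendsto (fun x : ℝ => deriv U x + Complex.I * k * U x)
      Filter.atTop (nhds 0)) :
    ∀ x : ℝ, x₁ ≤ x → U x = 0 := by
  have hV : ContDiff ℝ 1 (deriv U) := ContDiff.deriv' (n := 1) (by simpa [one_add_one_eq_two] using hU)
  have hUc : Continuous U := hU.continuous
  have hVc : Continuous (deriv U) := hV.continuous
  have hUd (x : ℝ) : HasDerivAt U (deriv U x) x :=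
    (hU.differentiable (by norm_num) x).hasDerivAt
  have hVd : ∀ x ∈ Set.Ioi x₁, HasDerivAt (deriv U) (-(((k ^ 2 * c x : ℝ) : ℂ) * U x)) x := by
    intro x hx
    have h : deriv (deriv U) x = -(((k ^ 2 * c x : ℝ) : ℂ) * U x) := by
      push_cast
      linear_combination heq x hx
    exact h ▸ (hV.differentiable (by norm_num) x).hasDerivAt
  have ha (x : ℝ) : HasDerivAt (fun x => (U x).re) (deriv U x).re x :=
    Complex.reCLM.hasFDerivAt.comp_hasDerivAt x (hUd x)
  have hb (x : ℝ) : HasDerivAt (fun x => (U x).im) (deriv U x).im x :=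
    Complex.imCLM.hasFDerivAt.comp_hasDerivAt x (hUd x)
  have hp : ∀ x ∈ Set.Ioi x₁,
      HasDerivAt (fun x => (deriv U x).re) (-(k ^ 2 * c x * (U x).re)) x := by
    intro x hx
    have h := Complex.reCLM.hasFDerivAt.comp_hasDerivAt x (hVd x hx)
    rw [Complex.reCLM_apply, Complex.neg_re, Complex.re_ofReal_mul] at h
    exact h
  have hq : ∀ x ∈ Set.Ioi x₁,
      HasDerivAt (fun x => (deriv U x).im) (-(k ^ 2 * c x * (U x).im)) x := by
    intro x hx
    have h := Complex.imCLM.hasFDerivAt.comp_hasDerivAt x (hVd x hx)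
    rw [Complex.imCLM_apply, Complex.neg_im, Complex.im_ofReal_mul] at h
    exact h
  have hW : ∀ x, x₁ ≤ x → (U x).re * (deriv U x).im - (U x).im * (deriv U x).re = 0 := by
    intro x hx
    have h := eq_of_hasDerivAt_zero_on_Ioi
      (f := fun x => (U x).re * (deriv U x).im - (U x).im * (deriv U x).re) (s := x₁)
      (by fun_prop) (fun y hy =>
        (((ha y).mul (hq y hy)).sub ((hb y).mul (hp y hy))).congr_deriv (by ring)) hx
    simpa [hU0] using h
  set E : ℝ → ℝ := fun x =>
    (deriv U x).re ^ 2 + (deriv U x).im ^ 2 + k ^ 2 * ((U x).re ^ 2 + (U x).im ^ 2) with hE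
  have hEc : Continuous E := by fun_prop
  have hE0 (x : ℝ) : 0 ≤ E x := by positivity
  have hEd : ∀ x ∈ Set.Ioi x₁, HasDerivAt E
      (2 * k ^ 2 * (1 - c x) * ((U x).re * (deriv U x).re + (U x).im * (deriv U x).im)) x := by
    intro x hx
    refine ((((hp x hx).pow 2).add ((hq x hx).pow 2)).add
      ((((ha x).pow 2).add ((hb x).pow 2)).const_mul (k ^ 2))).congr_deriv ?_
    push_cast
    ring
  have hElim : Filter.Tendsto E Filter.atTop (nhds 0) := by
    have h := (Complex.continuous_normSq.tendsto 0).comp hrad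
    rw [map_zero] at h
    refine h.congr' ?_
    filter_upwards [Filter.eventually_ge_atTop x₁] with x hx
    simp only [Function.comp_apply, Complex.normSq_apply, hE, Complex.add_re, Complex.add_im,
      Complex.mul_re, Complex.mul_im, Complex.I_re, Complex.I_im, Complex.ofReal_re,
      Complex.ofReal_im]
    linear_combination 2 * k * hW x hx
  have hEfar : ∀ x, max 1 x₁ ≤ x → E x = 0 := by
    have hconst : ∀ x, max 1 x₁ ≤ x → E x = E (max 1 x₁) := fun x hx =>
      eq_of_hasDerivAt_zero_on_Ioi hEc (fun y hy =>
        (hEd y ((le_max_right 1 x₁).trans_lt hy)).congr_deriv (by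
          rw [hc1 y ((le_max_left 1 x₁).trans (le_of_lt hy))]
          ring)) hx
    have hlim : E (max 1 x₁) = 0 := by
      refine tendsto_nhds_unique (tendsto_const_nhds.congr' ?_) hElim
      filter_upwards [Filter.eventually_ge_atTop (max 1 x₁)] with x hx
      exact (hconst x hx).symm
    exact fun x hx => (hconst x hx).trans hlim
  obtain ⟨C, hC⟩ := (isCompact_Icc (a := x₁) (b := max 1 x₁)).exists_bound_of_continuousOn
    (f := fun x => 1 - c x) (by fun_prop)
  have hEnear := eq_zero_of_neg_mul_le_deriv (K := k * C) hEc hE0 (fun x hx => hEd x hx.1)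
    (fun x hx => by
      have hCx := abs_le.1 (hC x (Set.Ioo_subset_Icc_self hx))
      have h₁ : 0 ≤ ((deriv U x).re + k * (U x).re) ^ 2 + ((deriv U x).im + k * (U x).im) ^ 2 := by
        positivity
      have h₂ : 0 ≤ ((deriv U x).re - k * (U x).re) ^ 2 + ((deriv U x).im - k * (U x).im) ^ 2 := by
        positivity
      have h₃ := mul_nonneg hk.le (mul_nonneg (by linarith [hCx.1] : 0 ≤ C + (1 - c x)) h₁)
      have h₄ := mul_nonneg hk.le (mul_nonneg (by linarith [hCx.2] : 0 ≤ C - (1 - c x)) h₂)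
      simp only [hE]
      linarith) (hEfar _ le_rfl)
  intro x hx
  have hEx : E x = 0 := (le_total x (max 1 x₁)).elim (fun h => hEnear x ⟨hx, h⟩) (hEfar x)
  have hk2 : 0 < k ^ 2 := by positivity
  have hUx : (U x).re ^ 2 + (U x).im ^ 2 = 0 := by
    simp only [hE] at hEx
    nlinarith [sq_nonneg (deriv U x).re, sq_nonneg (deriv U x).im, sq_nonneg (U x).re,
      sq_nonneg (U x).im]
  rw [← Complex.normSq_eq_zero, Complex.normSq_apply]
  linarith
end

section
/- Fix α > 0, functions a, b ∈ C([0,1], ℂ), d ∈ C([0,1], ℂ), and complex numbers p₀, p₁. For w ∈ C³([0,1], ℂ) define L w = w'' + a w' + b w, J_α(w) = ½ ( ∫₀¹ |L w(x) − d(x)|² dx + α Σ_{j=0}^{3} ∫₀¹ |w^{(j)}(x)|² dx ), and let W = { w ∈ C³([0,1], ℂ) : w(0) = p₀, w'(0) = p₁, w'(1) = 0 }. Then J_α has at most one minimizer over W: if w₁, w₂ ∈ W satisfy J_α(w₁) = J_α(w₂) = inf_{w ∈ W} J_α(w), then w₁ = w₂. -/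
open MeasureTheory

/-- The second-order operator L w = w'' + a w' + b w. -/
noncomputable def Lop (a b w : ℝ → ℂ) : ℝ → ℂ :=
  fun x => deriv (deriv w) x + a x * deriv w x + b x * w x

/-- The squared H³(0,1)-norm: Σ_{j=0}^{3} ∫₀¹ |w^{(j)}|² dx. -/
noncomputable def H3sq (w : ℝ → ℂ) : ℝ :=
  ∑ j ∈ Finset.range 4, ∫ x in (0:ℝ)..1, ‖iteratedDeriv j w x‖ ^ 2

/-- The quasi-reversibility (Tikhonov-regularized least-squares) functional J_α. -/
noncomputable def Jfun (α : ℝ) (a b d w : ℝ → ℂ) : ℝ :=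
  (1 / 2) * ((∫ x in (0:ℝ)..1, ‖Lop a b w x - d x‖ ^ 2) + α * H3sq w)

/-- The parallelogram identity, integrated over `[0, 1]`. -/
lemma integral_norm_sq_midpoint {f g : ℝ → ℂ}
    (hf : ContinuousOn f (Set.Icc 0 1)) (hg : ContinuousOn g (Set.Icc 0 1)) :
    (∫ x in (0:ℝ)..1, ‖(f x + g x) / 2‖ ^ 2) + (∫ x in (0:ℝ)..1, ‖(f x - g x) / 2‖ ^ 2) =
      ((∫ x in (0:ℝ)..1, ‖f x‖ ^ 2) + ∫ x in (0:ℝ)..1, ‖g x‖ ^ 2) / 2 := by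
  have hI : ∀ {u : ℝ → ℂ}, ContinuousOn u (Set.Icc 0 1) →
      IntervalIntegrable (fun x => ‖u x‖ ^ 2) volume 0 1 := fun hu =>
    ContinuousOn.intervalIntegrable_of_Icc zero_le_one (hu.norm.pow 2)
  rw [← intervalIntegral.integral_add (hI (u := fun x => (f x + g x) / 2) ((hf.add hg).div_const 2))
      (hI (u := fun x => (f x - g x) / 2) ((hf.sub hg).div_const 2)),
    ← intervalIntegral.integral_add (hI hf) (hI hg), ← intervalIntegral.integral_div]
  refine intervalIntegral.integral_congr fun x _ => ?_
  have h := parallelogram_law_with_norm ℝ (f x) (g x)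
  simp only [norm_div, Complex.norm_ofNat]
  linarith

lemma integral_norm_sq_midpoint_le {f g : ℝ → ℂ}
    (hf : ContinuousOn f (Set.Icc 0 1)) (hg : ContinuousOn g (Set.Icc 0 1)) :
    (∫ x in (0:ℝ)..1, ‖(f x + g x) / 2‖ ^ 2) ≤
      ((∫ x in (0:ℝ)..1, ‖f x‖ ^ 2) + ∫ x in (0:ℝ)..1, ‖g x‖ ^ 2) / 2 := by
  have h : 0 ≤ ∫ x in (0:ℝ)..1, ‖(f x - g x) / 2‖ ^ 2 :=
    intervalIntegral.integral_nonneg zero_le_one fun x _ => by positivity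
  linarith [integral_norm_sq_midpoint hf hg]

lemma iteratedDeriv_midpoint {n j : ℕ} (hj : j ≤ n) {f g : ℝ → ℂ}
    (hf : ContDiff ℝ n f) (hg : ContDiff ℝ n g) (x : ℝ) :
    iteratedDeriv j (fun x => (f x + g x) / 2) x =
      (iteratedDeriv j f x + iteratedDeriv j g x) / 2 := by
  induction j generalizing x with
  | zero => simp
  | succ k ih =>
    have hk : (k : WithTop ℕ∞) < n := by exact_mod_cast hj
    simp only [iteratedDeriv_succ]
    rw [funext (ih (by omega)), deriv_div_const,
      deriv_fun_add (hf.differentiable_iteratedDeriv k hk x)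
        (hg.differentiable_iteratedDeriv k hk x)]

lemma Lop_eq_iteratedDeriv (a b w : ℝ → ℂ) (x : ℝ) :
    Lop a b w x = iteratedDeriv 2 w x + a x * iteratedDeriv 1 w x + b x * w x := by
  simp [Lop, iteratedDeriv_succ]

/-- Quantitative midpoint convexity of `J_α`. -/
lemma Jfun_midpoint_add_le {α : ℝ} (hα : 0 < α) {a b d : ℝ → ℂ}
    (ha : ContinuousOn a (Set.Icc 0 1)) (hb : ContinuousOn b (Set.Icc 0 1))
    (hd : ContinuousOn d (Set.Icc 0 1))
    {f g : ℝ → ℂ} (hf : ContDiff ℝ 3 f) (hg : ContDiff ℝ 3 g) :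
    Jfun α a b d (fun x => (f x + g x) / 2) +
        α / 2 * (∫ x in (0:ℝ)..1, ‖(f x - g x) / 2‖ ^ 2) ≤
      (Jfun α a b d f + Jfun α a b d g) / 2 := by
  have hder : ∀ j ≤ 3, ∀ x, iteratedDeriv j (fun x => (f x + g x) / 2) x =
      (iteratedDeriv j f x + iteratedDeriv j g x) / 2 := fun j hj x =>
    iteratedDeriv_midpoint hj hf hg x
  have hcont : ∀ {u : ℝ → ℂ}, ContDiff ℝ 3 u → ∀ j ≤ 3,
      ContinuousOn (iteratedDeriv j u) (Set.Icc 0 1) := fun hu j hj =>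
    (hu.continuous_iteratedDeriv j (by exact_mod_cast hj)).continuousOn
  have hres : ∀ {u : ℝ → ℂ}, ContDiff ℝ 3 u →
      ContinuousOn (fun x => Lop a b u x - d x) (Set.Icc 0 1) := fun hu => by
    simp only [Lop_eq_iteratedDeriv]
    exact (((hcont hu 2 (by norm_num)).add (ha.mul (hcont hu 1 (by norm_num)))).add
      (hb.mul hu.continuous.continuousOn)).sub hd
  have hL : ∀ x, Lop a b (fun x => (f x + g x) / 2) x - d x =
      ((Lop a b f x - d x) + (Lop a b g x - d x)) / 2 := fun x => by
    simp only [Lop_eq_iteratedDeriv, hder 1 (by norm_num), hder 2 (by norm_num)]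
    ring
  have h0 := integral_norm_sq_midpoint (hcont hf 0 (by norm_num)) (hcont hg 0 (by norm_num))
  have h1 := integral_norm_sq_midpoint_le (hcont hf 1 (by norm_num)) (hcont hg 1 (by norm_num))
  have h2 := integral_norm_sq_midpoint_le (hcont hf 2 (by norm_num)) (hcont hg 2 (by norm_num))
  have h3 := integral_norm_sq_midpoint_le (hcont hf 3 (by norm_num)) (hcont hg 3 (by norm_num))
  have hr := integral_norm_sq_midpoint_le (hres hf) (hres hg)
  have hH : H3sq (fun x => (f x + g x) / 2) + (∫ x in (0:ℝ)..1, ‖(f x - g x) / 2‖ ^ 2) ≤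
      (H3sq f + H3sq g) / 2 := by
    simp only [H3sq, Finset.sum_range_succ, Finset.sum_range_zero, hder 1 (by norm_num),
      hder 2 (by norm_num), hder 3 le_rfl, iteratedDeriv_zero] at h0 ⊢
    linarith
  have hαH := mul_le_mul_of_nonneg_left hH hα.le
  simp only [Jfun, hL]
  linarith

/-- Uniqueness of the minimizer of the quasi-reversibility functional J_α over the
affine set W = {w ∈ C³([0,1]) : w(0) = p₀, w'(0) = p₁, w'(1) = 0}. -/
theorem qrm_minimizer_unique
    (α : ℝ) (hα : 0 < α) (a b d : ℝ → ℂ)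
    (ha : ContinuousOn a (Set.Icc 0 1)) (hb : ContinuousOn b (Set.Icc 0 1))
    (hd : ContinuousOn d (Set.Icc 0 1)) (p₀ p₁ : ℂ)
    (w₁ w₂ : ℝ → ℂ) (hw₁ : ContDiff ℝ 3 w₁) (hw₂ : ContDiff ℝ 3 w₂)
    (hbc₁ : w₁ 0 = p₀ ∧ deriv w₁ 0 = p₁ ∧ deriv w₁ 1 = 0)
    (hbc₂ : w₂ 0 = p₀ ∧ deriv w₂ 0 = p₁ ∧ deriv w₂ 1 = 0)
    (hmin₁ : ∀ v : ℝ → ℂ, ContDiff ℝ 3 v → v 0 = p₀ → deriv v 0 = p₁ → deriv v 1 = 0 →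
      Jfun α a b d w₁ ≤ Jfun α a b d v)
    (hmin₂ : ∀ v : ℝ → ℂ, ContDiff ℝ 3 v → v 0 = p₀ → deriv v 0 = p₁ → deriv v 1 = 0 →
      Jfun α a b d w₂ ≤ Jfun α a b d v) :
    ∀ x ∈ Set.Icc (0:ℝ) 1, w₁ x = w₂ x := by
  set v : ℝ → ℂ := fun x => (w₁ x + w₂ x) / 2 with hv
  have hvd : ∀ x, deriv v x = (deriv w₁ x + deriv w₂ x) / 2 := fun x => by
    simpa only [iteratedDeriv_one] using
      iteratedDeriv_midpoint (n := 3) (j := 1) (by norm_num) hw₁ hw₂ x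
  have hvC : ContDiff ℝ 3 v := (hw₁.add hw₂).div_const 2
  have hv0 : v 0 = p₀ := by simp [hv, hbc₁.1, hbc₂.1]
  have hv0' : deriv v 0 = p₁ := by simp [hvd, hbc₁.2.1, hbc₂.2.1]
  have hv1' : deriv v 1 = 0 := by simp [hvd, hbc₁.2.2, hbc₂.2.2]
  have h₁ := hmin₁ v hvC hv0 hv0' hv1'
  have h₂ := hmin₂ v hvC hv0 hv0' hv1'
  have hconv := Jfun_midpoint_add_le hα ha hb hd hw₁ hw₂
  intro x hx
  by_contra hne
  have hpos : 0 < ∫ x in (0:ℝ)..1, ‖(w₁ x - w₂ x) / 2‖ ^ 2 := by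
    refine intervalIntegral.integral_pos zero_lt_one
      (((hw₁.continuous.sub hw₂.continuous).div_const 2).norm.pow 2).continuousOn
      (fun x _ => by positivity) ⟨x, hx, ?_⟩
    have : (w₁ x - w₂ x) / 2 ≠ 0 := div_ne_zero (sub_ne_zero.mpr hne) two_ne_zero
    positivity
  have := mul_pos (half_pos hα) hpos
  linarith
end

section
/- Fix functions a, b ∈ C([0,1], ℂ). For α ∈ (0,1), d ∈ C([0,1], ℂ) and p₀, p₁ ∈ ℂ, define for w ∈ C³([0,1], ℂ): L w = w'' + a w' + b w, J_α(w) = ½ ( ∫₀¹ |L w(x) − d(x)|² dx + α Σ_{j=0}^{3} ∫₀¹ |w^{(j)}(x)|² dx ), and W = { w ∈ C³([0,1], ℂ) : w(0) = p₀, w'(0) = p₁, w'(1) = 0 }. Then there exists a constant C₁ > 0, depending only on ‖a‖_{C[0,1]} and ‖b‖_{C[0,1]}, such that every w_α ∈ W satisfying J_α(w_α) ≤ J_α(v) for all v ∈ W obeys ( Σ_{j=0}^{3} ∫₀¹ |w_α^{(j)}(x)|² dx )^{1/2} ≤ (C₁/√α) ( |p₀| + |p₁| + ( ∫₀¹ |d(x)|²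 dx )^{1/2} ). -/
open MeasureTheory

/-- The quadratic extension of the boundary data: its value at 0 is p₀, its derivative is p₁
at 0 and vanishes at 1. -/
noncomputable def quadExt (p₀ p₁ : ℂ) : ℝ → ℂ :=
  fun x => p₀ + p₁ * ((x : ℂ) - (x : ℂ) ^ 2 / 2)

lemma deriv_quadExt (p₀ p₁ : ℂ) :
    deriv (quadExt p₀ p₁) = fun x : ℝ => p₁ * (1 - (x : ℂ)) := by
  funext x
  have h : HasDerivAt (fun x : ℝ => (x : ℂ)) 1 x := Complex.ofRealCLM.hasDerivAt
  have h2 := (((h.sub ((h.pow 2).div_const 2)).const_mul p₁).const_add p₀).deriv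
  refine Eq.trans h2 ?_
  push_cast
  ring

lemma deriv_deriv_quadExt (p₀ p₁ : ℂ) :
    deriv (deriv (quadExt p₀ p₁)) = fun _ => -p₁ := by
  rw [deriv_quadExt]
  funext x
  have h : HasDerivAt (fun x : ℝ => (x : ℂ)) 1 x := Complex.ofRealCLM.hasDerivAt
  simpa using ((h.const_sub 1).const_mul p₁).deriv

lemma contDiff_quadExt (p₀ p₁ : ℂ) {n : WithTop ℕ∞} : ContDiff ℝ n (quadExt p₀ p₁) := by
  have h : ContDiff ℝ n (fun x : ℝ => (x : ℂ)) := Complex.ofRealCLM.contDiff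
  exact contDiff_const.add (contDiff_const.mul (h.sub ((h.pow 2).div_const 2)))

lemma norm_quadExt_le (p₀ p₁ : ℂ) {x : ℝ} (hx : x ∈ Set.Icc (0:ℝ) 1) :
    ‖quadExt p₀ p₁ x‖ ≤ ‖p₀‖ + ‖p₁‖ := by
  obtain ⟨h0, h1⟩ := hx
  refine (norm_add_le _ _).trans ?_
  rw [norm_mul]
  have : ‖(x : ℂ) - (x : ℂ) ^ 2 / 2‖ ≤ 1 := by
    have e : (x : ℂ) - (x : ℂ) ^ 2 / 2 = ((x - x ^ 2 / 2 : ℝ) : ℂ) := by push_cast; ring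
    rw [e, Complex.norm_real, Real.norm_eq_abs, abs_le]
    constructor <;> nlinarith
  gcongr
  exact mul_le_of_le_one_right (norm_nonneg _) this

lemma norm_deriv_quadExt_le (p₀ p₁ : ℂ) {x : ℝ} (hx : x ∈ Set.Icc (0:ℝ) 1) :
    ‖deriv (quadExt p₀ p₁) x‖ ≤ ‖p₁‖ := by
  obtain ⟨h0, h1⟩ := hx
  have : ‖(1 : ℂ) - (x : ℂ)‖ ≤ 1 := by
    have e : (1 : ℂ) - (x : ℂ) = ((1 - x : ℝ) : ℂ) := by push_cast; ring
    rw [e, Complex.norm_real, Real.norm_eq_abs, abs_le]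
    constructor <;> linarith
  rw [deriv_quadExt, norm_mul]
  exact mul_le_of_le_one_right (norm_nonneg _) this

lemma norm_iteratedDeriv_quadExt_le (p₀ p₁ : ℂ) {j : ℕ} (hj : j < 4) {x : ℝ}
    (hx : x ∈ Set.Icc (0:ℝ) 1) :
    ‖iteratedDeriv j (quadExt p₀ p₁) x‖ ≤ ‖p₀‖ + ‖p₁‖ := by
  have hp := norm_nonneg p₀
  have hq := norm_nonneg p₁
  interval_cases j
  · simpa using norm_quadExt_le p₀ p₁ hx
  · rw [iteratedDeriv_one]
    linarith [norm_deriv_quadExt_le p₀ p₁ hx]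
  · rw [iteratedDeriv_succ, iteratedDeriv_one, deriv_deriv_quadExt, norm_neg]
    linarith
  · rw [iteratedDeriv_succ, iteratedDeriv_succ, iteratedDeriv_one, deriv_deriv_quadExt]
    simp only [deriv_const, norm_zero]
    linarith

lemma H3sq_quadExt_le (p₀ p₁ : ℂ) : H3sq (quadExt p₀ p₁) ≤ 4 * (‖p₀‖ + ‖p₁‖) ^ 2 := by
  have key : ∀ j ∈ Finset.range 4,
      ∫ x in (0:ℝ)..1, ‖iteratedDeriv j (quadExt p₀ p₁) x‖ ^ 2 ≤ (‖p₀‖ + ‖p₁‖) ^ 2 := by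
    intro j hj
    have hc : Continuous (iteratedDeriv j (quadExt p₀ p₁)) :=
      (contDiff_quadExt p₀ p₁ (n := j)).continuous_iteratedDeriv j le_rfl
    calc ∫ x in (0:ℝ)..1, ‖iteratedDeriv j (quadExt p₀ p₁) x‖ ^ 2
        ≤ ∫ _ in (0:ℝ)..1, (‖p₀‖ + ‖p₁‖) ^ 2 := by
          refine intervalIntegral.integral_mono_on zero_le_one
            ((hc.norm.pow 2).intervalIntegrable _ _) (by simp) fun x hx => ?_
          gcongr
          exact norm_iteratedDeriv_quadExt_le p₀ p₁ (Finset.mem_range.mp hj) hx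
      _ = (‖p₀‖ + ‖p₁‖) ^ 2 := by simp
  simpa [H3sq] using Finset.sum_le_card_nsmul _ _ _ key

lemma norm_Lop_quadExt_le {A B : ℝ} {a b : ℝ → ℂ} (p₀ p₁ : ℂ) {x : ℝ}
    (hx : x ∈ Set.Icc (0:ℝ) 1) (ha : ‖a x‖ ≤ A) (hb : ‖b x‖ ≤ B) :
    ‖Lop a b (quadExt p₀ p₁) x‖ ≤ (1 + A + B) * (‖p₀‖ + ‖p₁‖) := by
  have hA : 0 ≤ A := (norm_nonneg _).trans ha
  have hB : 0 ≤ B := (norm_nonneg _).trans hb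
  have hp := norm_nonneg p₀
  have h0 := norm_quadExt_le p₀ p₁ hx
  have h1 : ‖deriv (quadExt p₀ p₁) x‖ ≤ ‖p₀‖ + ‖p₁‖ := by
    linarith [norm_deriv_quadExt_le p₀ p₁ hx]
  have h2 : ‖deriv (deriv (quadExt p₀ p₁)) x‖ ≤ ‖p₀‖ + ‖p₁‖ := by
    rw [deriv_deriv_quadExt, norm_neg]
    linarith
  calc ‖Lop a b (quadExt p₀ p₁) x‖
      ≤ ‖deriv (deriv (quadExt p₀ p₁)) x‖ + ‖a x‖ * ‖deriv (quadExt p₀ p₁) x‖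
        + ‖b x‖ * ‖quadExt p₀ p₁ x‖ := by
        simpa only [Lop, norm_mul] using norm_add₃_le
          (a := deriv (deriv (quadExt p₀ p₁)) x) (b := a x * deriv (quadExt p₀ p₁) x)
          (c := b x * quadExt p₀ p₁ x)
    _ ≤ (‖p₀‖ + ‖p₁‖) + A * (‖p₀‖ + ‖p₁‖) + B * (‖p₀‖ + ‖p₁‖) := by gcongr
    _ = _ := by ring

lemma integral_Lop_quadExt_sub_le {A B : ℝ} {a b d : ℝ → ℂ}
    (hac : ContinuousOn a (Set.Icc 0 1)) (hbc : ContinuousOn b (Set.Icc 0 1))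
    (ha : ∀ x ∈ Set.Icc (0:ℝ) 1, ‖a x‖ ≤ A) (hb : ∀ x ∈ Set.Icc (0:ℝ) 1, ‖b x‖ ≤ B)
    (hdc : ContinuousOn d (Set.Icc 0 1)) (p₀ p₁ : ℂ) :
    ∫ x in (0:ℝ)..1, ‖Lop a b (quadExt p₀ p₁) x - d x‖ ^ 2 ≤
      2 * ((1 + A + B) * (‖p₀‖ + ‖p₁‖)) ^ 2 + 2 * ∫ x in (0:ℝ)..1, ‖d x‖ ^ 2 := by
  have hd2 : IntervalIntegrable (fun x => 2 * ‖d x‖ ^ 2) volume 0 1 :=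
    (continuousOn_const.mul (hdc.norm.pow 2)).intervalIntegrable_of_Icc zero_le_one
  have hL : ContinuousOn (Lop a b (quadExt p₀ p₁)) (Set.Icc 0 1) := by
    have h0 : Continuous (quadExt p₀ p₁) := (contDiff_quadExt p₀ p₁ (n := 0)).continuous
    have h1 : Continuous (deriv (quadExt p₀ p₁)) := by rw [deriv_quadExt]; fun_prop
    have h2 : Continuous (deriv (deriv (quadExt p₀ p₁))) := by
      rw [deriv_deriv_quadExt]; fun_prop
    exact (h2.continuousOn.add (hac.mul h1.continuousOn)).add (hbc.mul h0.continuousOn)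
  calc ∫ x in (0:ℝ)..1, ‖Lop a b (quadExt p₀ p₁) x - d x‖ ^ 2
      ≤ ∫ x in (0:ℝ)..1, (2 * ((1 + A + B) * (‖p₀‖ + ‖p₁‖)) ^ 2 + 2 * ‖d x‖ ^ 2) := by
        refine intervalIntegral.integral_mono_on zero_le_one
          (((hL.sub hdc).norm.pow 2).intervalIntegrable_of_Icc zero_le_one)
          (intervalIntegrable_const.add hd2) fun x hx => ?_
        have h1 := norm_Lop_quadExt_le p₀ p₁ hx (ha x hx) (hb x hx)
        have h2 := norm_sub_le (Lop a b (quadExt p₀ p₁) x) (d x)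
        calc ‖Lop a b (quadExt p₀ p₁) x - d x‖ ^ 2
            ≤ ((1 + A + B) * (‖p₀‖ + ‖p₁‖) + ‖d x‖) ^ 2 := by
              gcongr
              linarith
          _ ≤ _ := by
              rw [← mul_add]
              exact add_sq_le
    _ = _ := by
        rw [intervalIntegral.integral_add intervalIntegrable_const hd2,
          intervalIntegral.integral_const_mul]
        simp

/-- A priori estimate for the minimizer of J_α: its H³-norm is bounded by
(C₁/√α)(|p₀| + |p₁| + ‖d‖_{L²}), with C₁ depending only on the sup-norms of a and b. -/
theorem qrm_minimizer_apriori_bound (A B : ℝ) :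
    ∃ C₁ : ℝ, 0 < C₁ ∧
      ∀ a b : ℝ → ℂ, ContinuousOn a (Set.Icc 0 1) → ContinuousOn b (Set.Icc 0 1) →
        (∀ x ∈ Set.Icc (0:ℝ) 1, ‖a x‖ ≤ A) → (∀ x ∈ Set.Icc (0:ℝ) 1, ‖b x‖ ≤ B) →
        ∀ α : ℝ, 0 < α → α < 1 →
        ∀ d : ℝ → ℂ, ContinuousOn d (Set.Icc 0 1) →
        ∀ p₀ p₁ : ℂ, ∀ wα : ℝ → ℂ, ContDiff ℝ 3 wα →
          wα 0 = p₀ → deriv wα 0 = p₁ → deriv wα 1 = 0 →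
          (∀ v : ℝ → ℂ, ContDiff ℝ 3 v → v 0 = p₀ → deriv v 0 = p₁ → deriv v 1 = 0 →
            Jfun α a b d wα ≤ Jfun α a b d v) →
          Real.sqrt (H3sq wα) ≤ (C₁ / Real.sqrt α) *
            (‖p₀‖ + ‖p₁‖ + Real.sqrt (∫ x in (0:ℝ)..1, ‖d x‖ ^ 2)) := by
  refine ⟨Real.sqrt (2 * (1 + A + B) ^ 2 + 6), Real.sqrt_pos.mpr (by positivity), ?_⟩
  intro a b hac hbc ha hb α hα hα1 d hdc p₀ p₁ w _ _ _ _ hmin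
  have hJ := hmin (quadExt p₀ p₁) (contDiff_quadExt p₀ p₁) (by simp [quadExt])
    (by simp [deriv_quadExt]) (by simp [deriv_quadExt])
  have hres : 0 ≤ ∫ x in (0:ℝ)..1, ‖Lop a b w x - d x‖ ^ 2 :=
    intervalIntegral.integral_nonneg zero_le_one fun _ _ => by positivity
  have hD : 0 ≤ ∫ x in (0:ℝ)..1, ‖d x‖ ^ 2 :=
    intervalIntegral.integral_nonneg zero_le_one fun _ _ => by positivity
  have hLv := integral_Lop_quadExt_sub_le hac hbc ha hb hdc p₀ p₁
  have hHv : α * H3sq (quadExt p₀ p₁) ≤ 4 * (‖p₀‖ + ‖p₁‖) ^ 2 :=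
    (mul_le_mul_of_nonneg_left (H3sq_quadExt_le p₀ p₁) hα.le).trans
      (mul_le_of_le_one_left (by positivity) hα1.le)
  unfold Jfun at hJ
  set P := ‖p₀‖ + ‖p₁‖
  set D := ∫ x in (0:ℝ)..1, ‖d x‖ ^ 2
  have hP : 0 ≤ P := by positivity
  have hsD : Real.sqrt D ^ 2 = D := Real.sq_sqrt hD
  have hbound : α * H3sq w ≤ (2 * (1 + A + B) ^ 2 + 6) * (P + Real.sqrt D) ^ 2 := by
    have hPS : 0 ≤ P * Real.sqrt D := by positivity
    have hKPS : 0 ≤ (1 + A + B) ^ 2 * (2 * (P * Real.sqrt D) + Real.sqrt D ^ 2) := by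
      positivity
    nlinarith [sq_nonneg P]
  rw [div_mul_eq_mul_div, le_div_iff₀ (Real.sqrt_pos.mpr hα), ← Real.sqrt_mul' _ hα.le,
    mul_comm (H3sq w)]
  calc Real.sqrt (α * H3sq w)
      ≤ Real.sqrt ((2 * (1 + A + B) ^ 2 + 6) * (P + Real.sqrt D) ^ 2) :=
        Real.sqrt_le_sqrt hbound
    _ = _ := by rw [Real.sqrt_mul (by positivity), Real.sqrt_sq (by positivity)]
end

section
/- Fix functions a, b ∈ C([0,1], ℂ) and let L w = w'' + a w' + b w. Let δ ∈ (0,1) and α ∈ (0,1). Suppose w* ∈ C³([0,1], ℂ) is an exact solution: L w* = d* on (0,1) with w*(0) = p₀*, (w*)'(0) = p₁*, (w*)'(1) = 0, for some d* ∈ C([0,1], ℂ) and p₀*, p₁* ∈ ℂ. Let d ∈ C([0,1], ℂ) and p₀, p₁ ∈ ℂ be noisy data with ( ∫₀¹ |d − d*|² dx )^{1/2} ≤ δ, |p₀ − p₀*| ≤ δ, |p₁ − p₁*| ≤ δ, and let w_α be a minimizer over W = { w ∈ C³([0,1], ℂ) : w(0) = p₀, w'(0) = p₁, w'(1) = 0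 } of J_α(w) = ½ ( ∫₀¹ |L w − d|² dx + α Σ_{j=0}^{3} ∫₀¹ |w^{(j)}|² dx ). Then there exists a constant C₂ > 0, depending only on ‖a‖_{C[0,1]} and ‖b‖_{C[0,1]}, such that ( Σ_{j=0}^{2} ∫₀¹ |w_α^{(j)} − (w*)^{(j)}|² dx )^{1/2} ≤ C₂ ( δ + √α + √α ( Σ_{j=0}^{3} ∫₀¹ |(w*)^{(j)}|² dx )^{1/2} ). In particular, if α = δ², then ( Σ_{j=0}^{2} ∫₀¹ |w_α^{(j)} − (w*)^{(j)}|² dx )^{1/2} ≤ C₂ ( 1 + ( Σ_{j=0}^{3} ∫₀¹ |(w*)^{(j)}|² dx )^{1/2} ) δ (with a possibly different constant C₂). -/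
open MeasureTheory

/-- The squared H²(0,1)-norm of the difference of two functions. -/
noncomputable def H2errSq (w₁ w₂ : ℝ → ℂ) : ℝ :=
  ∑ j ∈ Finset.range 3, ∫ x in (0:ℝ)..1, ‖iteratedDeriv j w₁ x - iteratedDeriv j w₂ x‖ ^ 2

/-- Energy (Gronwall) estimate for a second-order differential inequality with `L²` forcing. -/
theorem energy_le_of_norm_deriv_deriv_le {A B : ℝ} {h : ℝ → ℂ} {g : ℝ → ℝ}
    (hh : ContDiff ℝ 2 h) (hg : ContinuousOn g (Set.Icc 0 1))
    (hbound : ∀ x ∈ Set.Icc (0:ℝ) 1,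
      ‖deriv (deriv h) x‖ ≤ g x + A * ‖deriv h x‖ + B * ‖h x‖) {x : ℝ}
    (hx : x ∈ Set.Icc (0:ℝ) 1) :
    ‖h x‖ ^ 2 + ‖deriv h x‖ ^ 2 ≤ Real.exp (2 + 3 * A ^ 2 + 3 * B ^ 2) *
      (‖h 0‖ ^ 2 + ‖deriv h 0‖ ^ 2 + 3 * ∫ t in (0:ℝ)..1, g t ^ 2) := by
  set K := 2 + 3 * A ^ 2 + 3 * B ^ 2 with hK
  have hK0 : 0 ≤ K := by positivity
  have h1 : ContDiff ℝ 1 (deriv h) := ContDiff.deriv' (n := 1) (by rwa [one_add_one_eq_two])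
  have hd0 : ∀ x, HasDerivAt h (deriv h x) x :=
    fun x => (hh.differentiable (by norm_num) x).hasDerivAt
  have hd1 : ∀ x, HasDerivAt (deriv h) (deriv (deriv h) x) x :=
    fun x => (h1.differentiable (by norm_num) x).hasDerivAt
  have hg2 : ContinuousOn (fun t => g t ^ 2) (Set.Icc 0 1) := hg.pow 2
  have hint : ∀ y ∈ Set.Icc (0:ℝ) 1, IntervalIntegrable (fun t => g t ^ 2) volume 0 y :=
    fun y hy => (hg2.mono (Set.Icc_subset_Icc_right hy.2)).intervalIntegrable_of_Icc hy.1
  have hEd : ∀ y, HasDerivAt (fun y => ‖h y‖ ^ 2 + ‖deriv h y‖ ^ 2)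
      (2 * inner ℝ (h y) (deriv h y) + 2 * inner ℝ (deriv h y) (deriv (deriv h) y)) y :=
    fun y => (hd0 y).norm_sq.add (hd1 y).norm_sq
  set φ : ℝ → ℝ := fun y => Real.exp (-K * y) * (‖h y‖ ^ 2 + ‖deriv h y‖ ^ 2)
    - 3 * ∫ t in (0:ℝ)..y, g t ^ 2 with hφ
  have hexp : ∀ y : ℝ, HasDerivAt (fun y => Real.exp (-K * y)) (Real.exp (-K * y) * (-K)) y :=
    fun y => by simpa using ((hasDerivAt_id y).const_mul (-K)).exp
  have hanti : AntitoneOn φ (Set.Icc 0 1) := by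
    have hder : ∀ y ∈ Set.Ioo (0:ℝ) 1, HasDerivAt φ
        (Real.exp (-K * y) * (-K) * (‖h y‖ ^ 2 + ‖deriv h y‖ ^ 2) + Real.exp (-K * y) *
          (2 * inner ℝ (h y) (deriv h y) + 2 * inner ℝ (deriv h y) (deriv (deriv h) y))
          - 3 * g y ^ 2) y := by
      intro y hy
      refine ((hexp y).mul (hEd y)).sub (HasDerivAt.const_mul 3 ?_)
      exact intervalIntegral.integral_hasDerivAt_right (hint y (Set.Ioo_subset_Icc_self hy))
        ((hg2.mono Set.Ioo_subset_Icc_self).stronglyMeasurableAtFilter isOpen_Ioo y hy)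
        (hg2.continuousAt (Icc_mem_nhds hy.1 hy.2))
    refine antitoneOn_of_deriv_nonpos (convex_Icc 0 1) ?_ ?_ ?_
    · refine ContinuousOn.sub (Continuous.continuousOn ?_) (continuousOn_const.mul ?_)
      · exact (Continuous.mul (by fun_prop) (continuous_iff_continuousAt.2 fun y =>
          (hEd y).continuousAt))
      · have := intervalIntegral.continuousOn_primitive_interval (μ := volume)
          (a := (0:ℝ)) (b := 1) (f := fun t => g t ^ 2)
          (by rw [Set.uIcc_of_le zero_le_one]; exact hg2.integrableOn_Icc)
        rwa [Set.uIcc_of_le zero_le_one] at this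
    · rw [interior_Icc]
      exact fun y hy => (hder y hy).differentiableAt.differentiableWithinAt
    · rw [interior_Icc]
      intro y hy
      rw [(hder y hy).deriv]
      have hb := hbound y (Set.Ioo_subset_Icc_self hy)
      have i1 := real_inner_le_norm (h y) (deriv h y)
      have i2 := real_inner_le_norm (deriv h y) (deriv (deriv h) y)
      have hsq : ‖deriv (deriv h) y‖ ^ 2 ≤
          3 * g y ^ 2 + 3 * A ^ 2 * ‖deriv h y‖ ^ 2 + 3 * B ^ 2 * ‖h y‖ ^ 2 := by
        have := pow_le_pow_left₀ (norm_nonneg _) hb 2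
        nlinarith [sq_nonneg (g y - A * ‖deriv h y‖), sq_nonneg (g y - B * ‖h y‖),
          sq_nonneg (A * ‖deriv h y‖ - B * ‖h y‖)]
      have key : 2 * inner ℝ (h y) (deriv h y) + 2 * inner ℝ (deriv h y) (deriv (deriv h) y)
          ≤ K * (‖h y‖ ^ 2 + ‖deriv h y‖ ^ 2) + 3 * g y ^ 2 := by
        have e1 := sq_nonneg (‖h y‖ - ‖deriv h y‖)
        have e2 := sq_nonneg (‖deriv h y‖ - ‖deriv (deriv h) y‖)
        have e3 : 0 ≤ A ^ 2 * ‖h y‖ ^ 2 := by positivity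
        have e4 : 0 ≤ B ^ 2 * ‖deriv h y‖ ^ 2 := by positivity
        rw [hK]
        nlinarith [sq_nonneg (‖h y‖)]
      have he1 : Real.exp (-K * y) ≤ 1 := Real.exp_le_one_iff.2 (by nlinarith [hy.1])
      nlinarith [mul_le_mul_of_nonneg_left key (Real.exp_pos (-K * y)).le,
        mul_le_mul_of_nonneg_right he1 (sq_nonneg (g y))]
  have h0x := hanti (Set.left_mem_Icc.2 zero_le_one) hx hx.1
  simp only [hφ, mul_zero, Real.exp_zero, one_mul, intervalIntegral.integral_same, sub_zero]
    at h0x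
  have hmono : ∫ t in (0:ℝ)..x, g t ^ 2 ≤ ∫ t in (0:ℝ)..1, g t ^ 2 :=
    intervalIntegral.integral_mono_interval le_rfl hx.1 hx.2
      (Filter.Eventually.of_forall fun t => sq_nonneg _) (hint 1 (by simp))
  set R := ‖h 0‖ ^ 2 + ‖deriv h 0‖ ^ 2 + 3 * ∫ t in (0:ℝ)..1, g t ^ 2
  have hle : Real.exp (-K * x) * (‖h x‖ ^ 2 + ‖deriv h x‖ ^ 2) ≤ R := by
    simp only [R]; linarith
  have hR : 0 ≤ R := le_trans (by positivity) hle
  calc ‖h x‖ ^ 2 + ‖deriv h x‖ ^ 2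
      = Real.exp (K * x) * (Real.exp (-K * x) * (‖h x‖ ^ 2 + ‖deriv h x‖ ^ 2)) := by
        rw [← mul_assoc, ← Real.exp_add]; simp
    _ ≤ Real.exp K * R := by
        refine mul_le_mul (Real.exp_le_exp.2 ?_) hle (by positivity) (Real.exp_pos _).le
        nlinarith [hx.2]

/-- `H²` stability of the initial value problem for a second-order differential inequality. -/
theorem integral_sq_norm_derivs_le {A B : ℝ} {h : ℝ → ℂ} {g : ℝ → ℝ}
    (hh : ContDiff ℝ 2 h) (hg : ContinuousOn g (Set.Icc 0 1))
    (hbound : ∀ x ∈ Set.Icc (0:ℝ) 1,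
      ‖deriv (deriv h) x‖ ≤ g x + A * ‖deriv h x‖ + B * ‖h x‖) :
    (∫ x in (0:ℝ)..1, ‖h x‖ ^ 2) + (∫ x in (0:ℝ)..1, ‖deriv h x‖ ^ 2)
      + (∫ x in (0:ℝ)..1, ‖deriv (deriv h) x‖ ^ 2) ≤
    (2 + 3 * A ^ 2 + 3 * B ^ 2) * (Real.exp (2 + 3 * A ^ 2 + 3 * B ^ 2) *
      (‖h 0‖ ^ 2 + ‖deriv h 0‖ ^ 2 + 3 * ∫ t in (0:ℝ)..1, g t ^ 2))
      + 3 * ∫ t in (0:ℝ)..1, g t ^ 2 := by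
  set M := Real.exp (2 + 3 * A ^ 2 + 3 * B ^ 2) *
      (‖h 0‖ ^ 2 + ‖deriv h 0‖ ^ 2 + 3 * ∫ t in (0:ℝ)..1, g t ^ 2) with hM
  have h1 : ContDiff ℝ 1 (deriv h) := ContDiff.deriv' (n := 1) (by rwa [one_add_one_eq_two])
  have c0 : Continuous fun x => ‖h x‖ ^ 2 := hh.continuous.norm.pow 2
  have c1 : Continuous fun x => ‖deriv h x‖ ^ 2 := h1.continuous.norm.pow 2
  have c01 : Continuous fun x => ‖h x‖ ^ 2 + ‖deriv h x‖ ^ 2 := c0.add c1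
  have c2 : Continuous fun x => ‖deriv (deriv h) x‖ ^ 2 :=
    (h1.continuous_deriv le_rfl).norm.pow 2
  have ig : IntervalIntegrable (fun t => g t ^ 2) volume 0 1 :=
    (hg.pow 2).intervalIntegrable_of_Icc zero_le_one
  rw [← intervalIntegral.integral_add (c0.intervalIntegrable _ _) (c1.intervalIntegrable _ _),
    ← intervalIntegral.integral_add (c01.intervalIntegrable _ _)
      (c2.intervalIntegrable _ _)]
  have hR : (∫ x in (0:ℝ)..1, ((2 + 3 * A ^ 2 + 3 * B ^ 2) * M + 3 * g x ^ 2)) =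
      (2 + 3 * A ^ 2 + 3 * B ^ 2) * M + 3 * ∫ t in (0:ℝ)..1, g t ^ 2 := by
    rw [intervalIntegral.integral_add (by simp) (ig.const_mul 3)]
    simp
  rw [← hR]
  refine intervalIntegral.integral_mono_on zero_le_one
    ((c01.add c2).intervalIntegrable _ _) ((by simp : IntervalIntegrable _ _ _ _).add
      (ig.const_mul 3)) fun y hy => ?_
  have hE := energy_le_of_norm_deriv_deriv_le hh hg hbound hy
  rw [← hM] at hE
  have := pow_le_pow_left₀ (norm_nonneg _) (hbound y hy) 2
  have hsq : ‖deriv (deriv h) y‖ ^ 2 ≤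
      3 * g y ^ 2 + 3 * A ^ 2 * ‖deriv h y‖ ^ 2 + 3 * B ^ 2 * ‖h y‖ ^ 2 := by
    nlinarith [sq_nonneg (g y - A * ‖deriv h y‖), sq_nonneg (g y - B * ‖h y‖),
      sq_nonneg (A * ‖deriv h y‖ - B * ‖h y‖)]
  have e3 : 0 ≤ A ^ 2 * ‖h y‖ ^ 2 := by positivity
  have e4 : 0 ≤ B ^ 2 * ‖deriv h y‖ ^ 2 := by positivity
  have := mul_le_mul_of_nonneg_left hE (by positivity : 0 ≤ 2 + 3 * A ^ 2 + 3 * B ^ 2)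
  nlinarith [sq_nonneg ‖h y‖, sq_nonneg ‖deriv h y‖]

theorem norm_add_sq_le_two_mul {E : Type*} [SeminormedAddCommGroup E] (u v : E) :
    ‖u + v‖ ^ 2 ≤ 2 * ‖u‖ ^ 2 + 2 * ‖v‖ ^ 2 := by
  nlinarith [pow_le_pow_left₀ (norm_nonneg _) (norm_add_le u v) 2, sq_nonneg (‖u‖ - ‖v‖)]

theorem integral_norm_add_sq_le {u v : ℝ → ℂ} (hu : ContinuousOn u (Set.Icc 0 1))
    (hv : ContinuousOn v (Set.Icc 0 1)) :
    (∫ x in (0:ℝ)..1, ‖u x + v x‖ ^ 2) ≤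
      2 * (∫ x in (0:ℝ)..1, ‖u x‖ ^ 2) + 2 * ∫ x in (0:ℝ)..1, ‖v x‖ ^ 2 := by
  have iu : IntervalIntegrable (fun x => ‖u x‖ ^ 2) volume 0 1 :=
    (hu.norm.pow 2).intervalIntegrable_of_Icc zero_le_one
  have iv : IntervalIntegrable (fun x => ‖v x‖ ^ 2) volume 0 1 :=
    (hv.norm.pow 2).intervalIntegrable_of_Icc zero_le_one
  rw [← intervalIntegral.integral_const_mul, ← intervalIntegral.integral_const_mul,
    ← intervalIntegral.integral_add (iu.const_mul 2) (iv.const_mul 2)]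
  exact intervalIntegral.integral_mono_on zero_le_one
    (((hu.add hv).norm.pow 2).intervalIntegrable_of_Icc zero_le_one)
    ((iu.const_mul 2).add (iv.const_mul 2)) fun x _ => norm_add_sq_le_two_mul _ _

theorem integral_norm_sq_le_sq {u : ℝ → ℂ} {C : ℝ} (hu : ContinuousOn u (Set.Icc 0 1))
    (h : ∀ x ∈ Set.Icc (0:ℝ) 1, ‖u x‖ ≤ C) : (∫ x in (0:ℝ)..1, ‖u x‖ ^ 2) ≤ C ^ 2 := by
  calc (∫ x in (0:ℝ)..1, ‖u x‖ ^ 2) ≤ ∫ _ in (0:ℝ)..1, C ^ 2 :=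
        intervalIntegral.integral_mono_on zero_le_one
          ((hu.norm.pow 2).intervalIntegrable_of_Icc zero_le_one) (by simp)
          fun x hx => pow_le_pow_left₀ (norm_nonneg _) (h x hx) 2
    _ = C ^ 2 := by simp

theorem H3sq_eq (w : ℝ → ℂ) :
    H3sq w = (∫ x in (0:ℝ)..1, ‖w x‖ ^ 2) + (∫ x in (0:ℝ)..1, ‖deriv w x‖ ^ 2)
      + (∫ x in (0:ℝ)..1, ‖deriv (deriv w) x‖ ^ 2)
      + ∫ x in (0:ℝ)..1, ‖deriv (deriv (deriv w)) x‖ ^ 2 := by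
  simp [H3sq, Finset.sum_range_succ, iteratedDeriv_succ]

theorem H3sq_nonneg (w : ℝ → ℂ) : 0 ≤ H3sq w :=
  Finset.sum_nonneg fun _ _ =>
    intervalIntegral.integral_nonneg zero_le_one fun _ _ => sq_nonneg _

theorem continuousOn_Lop {a b w : ℝ → ℂ} (ha : ContinuousOn a (Set.Icc 0 1))
    (hb : ContinuousOn b (Set.Icc 0 1)) (hw : ContDiff ℝ 3 w) :
    ContinuousOn (Lop a b w) (Set.Icc 0 1) := by
  have h1 : ContDiff ℝ 2 (deriv w) := ContDiff.deriv' (n := 2) (by exact_mod_cast hw)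
  have h2 : Continuous (deriv (deriv w)) := h1.continuous_deriv (by norm_num)
  exact (h2.continuousOn.add (ha.mul h1.continuous.continuousOn)).add
    (hb.mul hw.continuous.continuousOn)

/-- The quadratic polynomial with value `q₀` and slope `q₁` at `0` and slope `0` at `1`. -/
noncomputable def boundaryCorrector (q₀ q₁ : ℂ) (x : ℝ) : ℂ := q₀ + q₁ * (x - x ^ 2 / 2)

theorem contDiff_boundaryCorrector (q₀ q₁ : ℂ) : ContDiff ℝ 3 (boundaryCorrector q₀ q₁) := by
  have : ContDiff ℝ 3 (fun x : ℝ => (x : ℂ)) := Complex.ofRealCLM.contDiff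
  unfold boundaryCorrector
  fun_prop

theorem deriv_boundaryCorrector (q₀ q₁ : ℂ) :
    deriv (boundaryCorrector q₀ q₁) = fun x : ℝ => q₁ * (1 - x) := by
  funext x
  have h : HasDerivAt (fun x : ℝ => (x : ℂ)) 1 x := Complex.ofRealCLM.hasDerivAt
  have hF : HasDerivAt (boundaryCorrector q₀ q₁) (q₁ * (1 - (2 : ℕ) * x ^ (2 - 1) * 1 / 2)) x :=
    ((h.sub ((h.pow 2).div_const 2)).const_mul q₁).const_add q₀
  simpa using hF.deriv

theorem deriv_deriv_boundaryCorrector (q₀ q₁ : ℂ) :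
    deriv (deriv (boundaryCorrector q₀ q₁)) = fun _ => -q₁ := by
  rw [deriv_boundaryCorrector]
  funext x
  have h : HasDerivAt (fun x : ℝ => (x : ℂ)) 1 x := Complex.ofRealCLM.hasDerivAt
  simpa using ((h.const_sub 1).const_mul q₁).deriv

theorem norm_boundaryCorrector_le {q₀ q₁ : ℂ} {δ x : ℝ} (h₀ : ‖q₀‖ ≤ δ) (h₁ : ‖q₁‖ ≤ δ)
    (hx : x ∈ Set.Icc (0:ℝ) 1) : ‖boundaryCorrector q₀ q₁ x‖ ≤ 2 * δ := by
  have hx' : ‖((x : ℂ) - x ^ 2 / 2)‖ ≤ 1 := by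
    have : ((x : ℂ) - x ^ 2 / 2) = ((x - x ^ 2 / 2 : ℝ) : ℂ) := by push_cast; ring
    rw [this, Complex.norm_real, Real.norm_eq_abs, abs_le]
    constructor <;> nlinarith [hx.1, hx.2]
  calc ‖boundaryCorrector q₀ q₁ x‖ ≤ ‖q₀‖ + ‖q₁‖ * ‖((x : ℂ) - x ^ 2 / 2)‖ := by
        rw [← norm_mul]; exact norm_add_le _ _
    _ ≤ 2 * δ := by nlinarith [norm_nonneg q₁, norm_nonneg ((x : ℂ) - x ^ 2 / 2)]

theorem norm_deriv_boundaryCorrector_le {q₀ q₁ : ℂ} {δ x : ℝ} (h₁ : ‖q₁‖ ≤ δ)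
    (hx : x ∈ Set.Icc (0:ℝ) 1) : ‖deriv (boundaryCorrector q₀ q₁) x‖ ≤ δ := by
  have hx' : ‖(1 - x : ℂ)‖ ≤ 1 := by
    have : (1 - x : ℂ) = ((1 - x : ℝ) : ℂ) := by push_cast; ring
    rw [this, Complex.norm_real, Real.norm_eq_abs, abs_le]
    constructor <;> linarith [hx.1, hx.2]
  rw [deriv_boundaryCorrector, norm_mul]
  nlinarith [norm_nonneg q₁, norm_nonneg (1 - x : ℂ)]

theorem deriv_add_contDiff {u v : ℝ → ℂ} (hu : ContDiff ℝ 1 u) (hv : ContDiff ℝ 1 v) :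
    deriv (fun x => u x + v x) = fun x => deriv u x + deriv v x := by
  funext x
  exact deriv_fun_add (hu.differentiable one_ne_zero x) (hv.differentiable one_ne_zero x)

theorem Lop_add {a b u v : ℝ → ℂ} (hu : ContDiff ℝ 2 u) (hv : ContDiff ℝ 2 v) (x : ℝ) :
    Lop a b (fun x => u x + v x) x = Lop a b u x + Lop a b v x := by
  have hu1 : ContDiff ℝ 1 (deriv u) := ContDiff.deriv' (n := 1) (by rwa [one_add_one_eq_two])
  have hv1 : ContDiff ℝ 1 (deriv v) := ContDiff.deriv' (n := 1) (by rwa [one_add_one_eq_two])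
  simp only [Lop]
  rw [deriv_add_contDiff (hu.of_le (by norm_num)) (hv.of_le (by norm_num)),
    deriv_add_contDiff hu1 hv1]
  ring

theorem H3sq_add_le {u v : ℝ → ℂ} (hu : ContDiff ℝ 3 u) (hv : ContDiff ℝ 3 v) :
    H3sq (fun x => u x + v x) ≤ 2 * H3sq u + 2 * H3sq v := by
  simp only [H3sq, Finset.mul_sum, ← Finset.sum_add_distrib]
  refine Finset.sum_le_sum fun j hj => ?_
  have hj3 : j ≤ 3 := Nat.lt_succ_iff.1 (Finset.mem_range.1 hj)
  have hle : (j : WithTop ℕ∞) ≤ 3 := by exact_mod_cast hj3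
  have hadd : ∀ x, iteratedDeriv j (fun x => u x + v x) x
      = iteratedDeriv j u x + iteratedDeriv j v x := fun x =>
    iteratedDeriv_fun_add (hu.of_le hle).contDiffAt (hv.of_le hle).contDiffAt
  simp only [hadd]
  exact integral_norm_add_sq_le (hu.continuous_iteratedDeriv j hle).continuousOn
    (hv.continuous_iteratedDeriv j hle).continuousOn

theorem H3sq_boundaryCorrector_le {q₀ q₁ : ℂ} {δ : ℝ} (h₀ : ‖q₀‖ ≤ δ) (h₁ : ‖q₁‖ ≤ δ) :
    H3sq (boundaryCorrector q₀ q₁) ≤ 6 * δ ^ 2 := by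
  have c0 := (contDiff_boundaryCorrector q₀ q₁).continuous
  have c1 := (contDiff_boundaryCorrector q₀ q₁).continuous_deriv (by norm_num)
  have i0 := integral_norm_sq_le_sq c0.continuousOn fun x hx => norm_boundaryCorrector_le h₀ h₁ hx
  have i1 := integral_norm_sq_le_sq c1.continuousOn fun x hx =>
    norm_deriv_boundaryCorrector_le (q₀ := q₀) h₁ hx
  have i2 : ‖q₁‖ ^ 2 ≤ δ ^ 2 := pow_le_pow_left₀ (norm_nonneg _) h₁ 2
  rw [H3sq_eq]
  simp only [deriv_deriv_boundaryCorrector]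
  simp
  linarith

theorem norm_Lop_boundaryCorrector_le {A B δ x : ℝ} {a b : ℝ → ℂ} {q₀ q₁ : ℂ}
    (ha : ‖a x‖ ≤ A) (hb : ‖b x‖ ≤ B) (h₀ : ‖q₀‖ ≤ δ) (h₁ : ‖q₁‖ ≤ δ)
    (hx : x ∈ Set.Icc (0:ℝ) 1) :
    ‖Lop a b (boundaryCorrector q₀ q₁) x‖ ≤ (1 + A + 2 * B) * δ := by
  have f0 := norm_boundaryCorrector_le h₀ h₁ hx
  have f1 := norm_deriv_boundaryCorrector_le (q₀ := q₀) h₁ hx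
  have g1 := mul_le_mul ha f1 (norm_nonneg _) ((norm_nonneg _).trans ha)
  have g0 := mul_le_mul hb f0 (norm_nonneg _) ((norm_nonneg _).trans hb)
  simp only [Lop]
  refine norm_add₃_le.trans ?_
  rw [norm_mul, norm_mul, deriv_deriv_boundaryCorrector, norm_neg]
  linarith

/-- Comparison of the minimizer with the corrected exact solution bounds the residual. -/
theorem integral_residual_sq_le {A B δ α : ℝ} {a b d dstar wstar wα : ℝ → ℂ}
    (ha : ContinuousOn a (Set.Icc 0 1)) (hb : ContinuousOn b (Set.Icc 0 1))
    (hA : ∀ x ∈ Set.Icc (0:ℝ) 1, ‖a x‖ ≤ A) (hB : ∀ x ∈ Set.Icc (0:ℝ) 1, ‖b x‖ ≤ B)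
    (hα0 : 0 < α) (hα1 : α < 1)
    (hds : ContinuousOn dstar (Set.Icc 0 1)) (hd : ContinuousOn d (Set.Icc 0 1))
    (hws : ContDiff ℝ 3 wstar) (heq : Set.EqOn (Lop a b wstar) dstar (Set.Icc 0 1))
    (hws1 : deriv wstar 1 = 0)
    (hdd : (∫ x in (0:ℝ)..1, ‖d x - dstar x‖ ^ 2) ≤ δ ^ 2)
    (h₀ : ‖wα 0 - wstar 0‖ ≤ δ) (h₁ : ‖deriv wα 0 - deriv wstar 0‖ ≤ δ)
    (hmin : ∀ v : ℝ → ℂ, ContDiff ℝ 3 v → v 0 = wα 0 → deriv v 0 = deriv wα 0 →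
      deriv v 1 = 0 → Jfun α a b d wα ≤ Jfun α a b d v) :
    (∫ x in (0:ℝ)..1, ‖Lop a b wα x - d x‖ ^ 2) ≤
      (14 + 2 * (1 + A + 2 * B) ^ 2) * δ ^ 2 + 2 * (α * H3sq wstar) := by
  set F := boundaryCorrector (wα 0 - wstar 0) (deriv wα 0 - deriv wstar 0) with hFdef
  have hF : ContDiff ℝ 3 F := contDiff_boundaryCorrector _ _
  have hderiv : deriv (fun x => wstar x + F x) = fun x => deriv wstar x + deriv F x :=
    deriv_add_contDiff (hws.of_le (by norm_num)) (hF.of_le (by norm_num))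
  have hJ := hmin (fun x => wstar x + F x) (hws.add hF) (by simp [hFdef, boundaryCorrector])
    (by rw [hderiv]; simp [hFdef, deriv_boundaryCorrector])
    (by rw [hderiv]; simp [hFdef, deriv_boundaryCorrector, hws1])
  have hcL := continuousOn_Lop ha hb hF
  have hres : (∫ x in (0:ℝ)..1, ‖Lop a b (fun x => wstar x + F x) x - d x‖ ^ 2) ≤
      2 * δ ^ 2 + 2 * ((1 + A + 2 * B) * δ) ^ 2 := by
    have hcongr : (∫ x in (0:ℝ)..1, ‖Lop a b (fun x => wstar x + F x) x - d x‖ ^ 2) =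
        ∫ x in (0:ℝ)..1, ‖-(d x - dstar x) + Lop a b F x‖ ^ 2 := by
      refine intervalIntegral.integral_congr fun x hx => ?_
      rw [Set.uIcc_of_le zero_le_one] at hx
      simp only [Lop_add (hws.of_le (by norm_num)) (hF.of_le (by norm_num)), heq hx]
      congr 2
      ring
    have h2 := integral_norm_sq_le_sq hcL fun x hx =>
      norm_Lop_boundaryCorrector_le (hA x hx) (hB x hx) h₀ h₁ hx
    have h3 := integral_norm_add_sq_le (hd.sub hds).neg hcL
    simp only [Pi.neg_apply, Pi.sub_apply, norm_neg] at h3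
    rw [hcongr]
    linarith
  have hH := H3sq_add_le hws hF
  have hHF := H3sq_boundaryCorrector_le h₀ h₁
  have hαH := mul_le_mul_of_nonneg_left hH hα0.le
  have hαF : α * H3sq F ≤ 6 * δ ^ 2 :=
    (mul_le_of_le_one_left (H3sq_nonneg F) hα1.le).trans hHF
  have hnn := mul_nonneg hα0.le (H3sq_nonneg wα)
  simp only [Jfun] at hJ
  nlinarith

/-- Convergence rate of the regularized (quasi-reversibility) solutions to the exact
solution in the H²(0,1)-norm, with constants depending only on the sup-norms of a, b. -/
theorem qrm_convergence_rate (A B : ℝ) :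
    ∃ C₂ : ℝ, 0 < C₂ ∧ ∃ C₂' : ℝ, 0 < C₂' ∧
      ∀ a b : ℝ → ℂ, ContinuousOn a (Set.Icc 0 1) → ContinuousOn b (Set.Icc 0 1) →
        (∀ x ∈ Set.Icc (0:ℝ) 1, ‖a x‖ ≤ A) → (∀ x ∈ Set.Icc (0:ℝ) 1, ‖b x‖ ≤ B) →
        ∀ δ α : ℝ, 0 < δ → δ < 1 → 0 < α → α < 1 →
        ∀ dstar : ℝ → ℂ, ContinuousOn dstar (Set.Icc 0 1) →
        ∀ p₀s p₁s : ℂ, ∀ wstar : ℝ → ℂ, ContDiff ℝ 3 wstar →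
          (∀ x ∈ Set.Ioo (0:ℝ) 1, Lop a b wstar x = dstar x) →
          wstar 0 = p₀s → deriv wstar 0 = p₁s → deriv wstar 1 = 0 →
        ∀ d : ℝ → ℂ, ContinuousOn d (Set.Icc 0 1) →
        ∀ p₀ p₁ : ℂ,
          Real.sqrt (∫ x in (0:ℝ)..1, ‖d x - dstar x‖ ^ 2) ≤ δ →
          ‖p₀ - p₀s‖ ≤ δ → ‖p₁ - p₁s‖ ≤ δ →
        ∀ wα : ℝ → ℂ, ContDiff ℝ 3 wα →
          wα 0 = p₀ → deriv wα 0 = p₁ → deriv wα 1 = 0 →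
          (∀ v : ℝ → ℂ, ContDiff ℝ 3 v → v 0 = p₀ → deriv v 0 = p₁ → deriv v 1 = 0 →
            Jfun α a b d wα ≤ Jfun α a b d v) →
          Real.sqrt (H2errSq wα wstar) ≤
              C₂ * (δ + Real.sqrt α + Real.sqrt α * Real.sqrt (H3sq wstar)) ∧
            (α = δ ^ 2 →
              Real.sqrt (H2errSq wα wstar) ≤ C₂' * (1 + Real.sqrt (H3sq wstar)) * δ) := by
  set K := 2 + 3 * A ^ 2 + 3 * B ^ 2 with hK
  set P := 30 + 4 * (1 + A + 2 * B) ^ 2 with hP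
  have hK0 : 0 < K := by positivity
  have hP0 : 30 ≤ P := by nlinarith [sq_nonneg (1 + A + 2 * B)]
  have hKe : 0 < K * Real.exp K := by positivity
  set N := K * Real.exp K * (2 + 3 * P) + 3 * P with hN
  have hN0 : 0 < N := by positivity
  have hN1 : 12 * (K * Real.exp K) + 12 ≤ N := by nlinarith
  refine ⟨Real.sqrt N, Real.sqrt_pos.2 hN0, 2 * Real.sqrt N, by positivity, ?_⟩
  intro a b ha hb hA hB δ α hδ0 hδ1 hα0 hα1 dstar hds p₀s p₁s wstar hws hL hws0 hws0' hws1
    d hd p₀ p₁ hdd hp₀ hp₁ wα hw hw0 hw0' hw1 hmin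
  subst hws0 hws0' hw0 hw0'
  have heq : Set.EqOn (Lop a b wstar) dstar (Set.Icc 0 1) :=
    Set.EqOn.of_subset_closure (fun x hx => hL x hx) (continuousOn_Lop ha hb hws) hds
      Set.Ioo_subset_Icc_self (by rw [closure_Ioo zero_ne_one])
  have hdd2 := (Real.sqrt_le_left hδ0.le).1 hdd
  have hres := integral_residual_sq_le ha hb hA hB hα0 hα1 hds hd hws heq hws1 hdd2 hp₀ hp₁ hmin
  have hcw := continuousOn_Lop ha hb hw
  have hG : (∫ x in (0:ℝ)..1, ‖Lop a b wα x - dstar x‖ ^ 2) ≤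
      P * δ ^ 2 + 4 * (α * H3sq wstar) := by
    have := integral_norm_add_sq_le (hcw.sub hd) (hd.sub hds)
    simp only [Pi.sub_apply, sub_add_sub_cancel] at this
    nlinarith
  have hws' : ContDiff ℝ 2 (deriv wstar) := ContDiff.deriv' (n := 2) (by exact_mod_cast hws)
  have hw' : ContDiff ℝ 2 (deriv wα) := ContDiff.deriv' (n := 2) (by exact_mod_cast hw)
  have hd1 : deriv (fun x => wα x - wstar x) = fun x => deriv wα x - deriv wstar x :=
    funext fun x => deriv_fun_sub (hw.differentiable (by norm_num) x)
      (hws.differentiable (by norm_num) x)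
  have hd2 : deriv (fun x => deriv wα x - deriv wstar x)
      = fun x => deriv (deriv wα) x - deriv (deriv wstar) x :=
    funext fun x => deriv_fun_sub (hw'.differentiable (by norm_num) x)
      (hws'.differentiable (by norm_num) x)
  have hstab := integral_sq_norm_derivs_le (A := A) (B := B) (h := fun x => wα x - wstar x)
    (g := fun x => ‖Lop a b wα x - dstar x‖) ((hw.sub hws).of_le (by norm_num))
    (hcw.sub hds).norm (fun x hx => by
      simp only [hd1, hd2]
      have hid : deriv (deriv wα) x - deriv (deriv wstar) x = (Lop a b wα x - dstar x)
          + -(a x * (deriv wα x - deriv wstar x)) + -(b x * (wα x - wstar x)) := by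
        rw [← heq hx]
        simp only [Lop]
        ring
      rw [hid]
      refine norm_add₃_le.trans ?_
      rw [norm_neg, norm_neg, norm_mul, norm_mul]
      gcongr
      · exact hA x hx
      · exact hB x hx)
  simp only [hd1, hd2] at hstab
  rw [← hK] at hstab
  have hE2 : H2errSq wα wstar = (∫ x in (0:ℝ)..1, ‖wα x - wstar x‖ ^ 2)
      + (∫ x in (0:ℝ)..1, ‖deriv wα x - deriv wstar x‖ ^ 2)
      + ∫ x in (0:ℝ)..1, ‖deriv (deriv wα) x - deriv (deriv wstar) x‖ ^ 2 := by
    simp [H2errSq, Finset.sum_range_succ, iteratedDeriv_succ]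
  rw [← hE2] at hstab
  have hS := H3sq_nonneg wstar
  set S := H3sq wstar
  have hαS : 0 ≤ α * S := mul_nonneg hα0.le hS
  have hmain : H2errSq wα wstar ≤ N * (δ ^ 2 + α * S) := by
    have q0 := pow_le_pow_left₀ (norm_nonneg _) hp₀ 2
    have q1 := pow_le_pow_left₀ (norm_nonneg _) hp₁ 2
    set G := ∫ x in (0:ℝ)..1, ‖Lop a b wα x - dstar x‖ ^ 2
    have hsum : ‖wα 0 - wstar 0‖ ^ 2 + ‖deriv wα 0 - deriv wstar 0‖ ^ 2 + 3 * G ≤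
        (2 + 3 * P) * δ ^ 2 + 12 * (α * S) := by linarith
    have h1 := mul_le_mul_of_nonneg_left hsum hKe.le
    have h2 := mul_le_mul_of_nonneg_right hN1 hαS
    have h3 : N * δ ^ 2 = K * Real.exp K * ((2 + 3 * P) * δ ^ 2) + 3 * P * δ ^ 2 := by
      rw [hN]; ring
    linarith
  have hroot : Real.sqrt (H2errSq wα wstar) ≤
      Real.sqrt N * (δ + Real.sqrt α * Real.sqrt S) := by
    refine Real.sqrt_le_iff.2 ⟨by positivity, hmain.trans ?_⟩
    rw [mul_pow, Real.sq_sqrt hN0.le]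
    refine mul_le_mul_of_nonneg_left ?_ hN0.le
    have : (Real.sqrt α * Real.sqrt S) ^ 2 = α * S := by
      rw [mul_pow, Real.sq_sqrt hα0.le, Real.sq_sqrt hS]
    nlinarith [mul_nonneg hδ0.le (mul_nonneg (Real.sqrt_nonneg α) (Real.sqrt_nonneg S))]
  refine ⟨hroot.trans (mul_le_mul_of_nonneg_left (by linarith [Real.sqrt_nonneg α])
    (Real.sqrt_nonneg N)), fun hαδ => hroot.trans ?_⟩
  rw [hαδ, Real.sqrt_sq hδ0.le]
  nlinarith [mul_nonneg (Real.sqrt_nonneg N) (mul_nonneg hδ0.le (Real.sqrt_nonneg S)),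
    mul_nonneg (Real.sqrt_nonneg N) hδ0.le]
end
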